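/- arXiv:math/0610892 — 10 statements merged into one kernel-verified Lean document; each statement's English description precedes it below -/
import Mathlib

section
/- Let F be a field of characteristic p (with the convention p = ∞ if F has characteristic zero), and let A and B be two finite nonempty subsets of F. Let P(x,y) be a polynomial over F of total degree d = deg P(x,y) such that for some integer i with 0 ≤ i ≤ |A|−1 the coefficient of x^i y^{d−i} in P is nonzero, and for some integer j with 0 ≤ j ≤ |B|−1 the coefficient of x^{d−j} y^j in P is nonzero. Let P₀(x,y) be the homogeneous part of P of degree d (i.e. P(x,y) = P₀(x,y) + R(x,y) with deg R < d), and set P*(x) = P₀(x,1). Let C = {a+b : a ∈ A, b ∈ B, and P(a,b) ≠ 0}. Then |C| ≥ min{p − m_{P*}(−1), |A| + |B| − 1 − d − N(P*)}. -/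
/-- The multiplicity `m_P(α)` of `α` (in the algebraic closure of `F`) as a root of the
polynomial `P` over `F`, viewed over the algebraic closure. -/
noncomputable def multAC {F : Type*} [Field F] (P : Polynomial F)
    (α : AlgebraicClosure F) : ℕ :=
  Polynomial.rootMultiplicity α (Polynomial.map (algebraMap F (AlgebraicClosure F)) P)

/-- `𝒫(p)`: the powers of `p` (including `1 = p^0`) when `p` is the (prime) characteristic,
and just `{1}` when the characteristic is zero (the case `p = ∞`). -/
def PPset (p : ℕ) : Set ℕ := if p = 0 then {1} else {q | ∃ k : ℕ, q = p ^ k}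

/-- `N(P) = max_{q ∈ 𝒫(p)} q·|{α ∈ E^× \ {−1} : m_P(α) ≥ q}|`, where `E` is the algebraic
closure of `F`. -/
noncomputable def NP {F : Type*} [Field F] (P : Polynomial F) : ℕ :=
  sSup {n : ℕ | ∃ q ∈ PPset (ringChar F),
    n = q * {α : AlgebraicClosure F | α ≠ 0 ∧ α ≠ -1 ∧ q ≤ multAC P α}.ncard}

/-- The homogeneous part of degree `d` of `P(x,y)` specialized at `y = 1`, i.e. the
univariate polynomial `P*(x) = P₀(x, 1)` where `P = P₀ + R`, `P₀` homogeneous of degree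
`d` and `deg R < d`. -/
noncomputable def Pstar {F : Type*} [Field F] (P : MvPolynomial (Fin 2) F) (d : ℕ) :
    Polynomial F :=
  (MvPolynomial.aeval ![Polynomial.X, (1 : Polynomial F)])
    ((MvPolynomial.homogeneousComponent d) P)

section BivariateLeadingForm

open MvPolynomial

theorem homogeneousComponent_mul_of_totalDegree_le {σ R : Type*} [CommSemiring R]
    {f g : MvPolynomial σ R} {m n : ℕ} (hf : f.totalDegree ≤ m) (hg : g.totalDegree ≤ n) :
    homogeneousComponent (m + n) (f * g) =
      homogeneousComponent m f * homogeneousComponent n g := by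
  classical
  ext t
  by_cases ht : t.degree = m + n
  · rw [coeff_homogeneousComponent, if_pos ht, coeff_mul, coeff_mul]
    refine Finset.sum_congr rfl fun x hx => ?_
    rw [Finset.HasAntidiagonal.mem_antidiagonal] at hx
    have hdeg : x.1.degree + x.2.degree = m + n := by rw [← ht, ← hx, map_add]
    rw [coeff_homogeneousComponent, coeff_homogeneousComponent]
    rcases lt_trichotomy x.1.degree m with h | h | h
    · have : coeff x.2 g = 0 := coeff_eq_zero_of_totalDegree_lt (by
        rw [← Finsupp.degree_apply]; omega)
      simp [this]
    · rw [if_pos h, if_pos (by omega)]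
    · have : coeff x.1 f = 0 := coeff_eq_zero_of_totalDegree_lt (by
        rw [← Finsupp.degree_apply]; omega)
      simp [this]
  · rw [coeff_homogeneousComponent, if_neg ht]
    exact (((homogeneousComponent_isHomogeneous m f).mul
      (homogeneousComponent_isHomogeneous n g)).coeff_eq_zero ht).symm

theorem totalDegree_prod_X_add_X_sub_C_le {F : Type*} [Field F] (s : Finset F) :
    (∏ c ∈ s, (X 0 + X 1 - C c : MvPolynomial (Fin 2) F)).totalDegree ≤ s.card := by
  refine (totalDegree_finsetProd _ _).trans ?_
  rw [Finset.card_eq_sum_ones]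
  refine Finset.sum_le_sum fun c _ => ?_
  refine (totalDegree_sub_C_le _ _).trans ((totalDegree_add _ _).trans ?_)
  simp

theorem homogeneousComponent_prod_X_add_X_sub_C {F : Type*} [Field F] (s : Finset F) :
    homogeneousComponent s.card (∏ c ∈ s, (X 0 + X 1 - C c : MvPolynomial (Fin 2) F)) =
      (X 0 + X 1) ^ s.card := by
  classical
  induction s using Finset.induction_on with
  | empty => simp [homogeneousComponent_zero]
  | insert c s hc ih =>
    have hdeg : (X 0 + X 1 - C c : MvPolynomial (Fin 2) F).totalDegree ≤ 1 := by
      simpa using totalDegree_prod_X_add_X_sub_C_le {c}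
    have hcomp : homogeneousComponent 1 (X 0 + X 1 - C c : MvPolynomial (Fin 2) F) =
        X 0 + X 1 := by
      rw [map_sub, homogeneousComponent_eq_self ((isHomogeneous_X F 0).add (isHomogeneous_X F 1)),
        homogeneousComponent_eq_zero 1 (C c) (by simp), sub_zero]
    rw [Finset.prod_insert hc, Finset.card_insert_of_notMem hc, add_comm s.card 1,
      homogeneousComponent_mul_of_totalDegree_le hdeg (totalDegree_prod_X_add_X_sub_C_le s),
      ih, hcomp, pow_add, pow_one]

theorem fin_two_finsupp_eq (t : Fin 2 →₀ ℕ) :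
    t = Finsupp.single 0 (t 0) + Finsupp.single 1 (t 1) := by
  ext k
  fin_cases k <;> simp

theorem coeff_Pstar {F : Type*} [Field F] (P : MvPolynomial (Fin 2) F) {d i : ℕ} (hi : i ≤ d) :
    (Pstar P d).coeff i = P.coeff (Finsupp.single 0 i + Finsupp.single 1 (d - i)) := by
  classical
  have hdeg : (Finsupp.single 0 i + Finsupp.single 1 (d - i) : Fin 2 →₀ ℕ).degree = d := by
    rw [map_add, Finsupp.degree_single, Finsupp.degree_single]; omega
  have hco := coeff_homogeneousComponent d P (Finsupp.single 0 i + Finsupp.single 1 (d - i))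
  rw [if_pos hdeg] at hco
  rw [← hco, Pstar, aeval_def, eval₂_eq', Polynomial.finsetSum_coeff]
  rw [Finset.sum_eq_single (Finsupp.single 0 i + Finsupp.single 1 (d - i))]
  · simp
  · intro t ht hne
    have htd : t.degree = d := by
      by_contra h
      exact (mem_support_iff.mp ht)
        ((homogeneousComponent_isHomogeneous d P).coeff_eq_zero h)
    have h0 : i ≠ t 0 := by
      intro h
      apply hne
      rw [fin_two_finsupp_eq t] at htd
      rw [map_add, Finsupp.degree_single, Finsupp.degree_single] at htd
      rw [fin_two_finsupp_eq t, h]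
      congr 2
      omega
    simp [Polynomial.coeff_X_pow, h0]
  · intro h
    rw [notMem_support_iff.mp h, map_zero, zero_mul, Polynomial.coeff_zero]

theorem natDegree_Pstar_le {F : Type*} [Field F] (P : MvPolynomial (Fin 2) F) (d : ℕ) :
    (Pstar P d).natDegree ≤ d := by
  rw [Pstar, aeval_def, eval₂_eq']
  refine Polynomial.natDegree_sum_le_of_forall_le _ _ fun t ht => ?_
  have htd : t.degree = d := by
    by_contra h
    exact (mem_support_iff.mp ht) ((homogeneousComponent_isHomogeneous d P).coeff_eq_zero h)
  rw [fin_two_finsupp_eq t, map_add, Finsupp.degree_single, Finsupp.degree_single] at htd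
  have : (∏ k, ![Polynomial.X, (1 : Polynomial F)] k ^ t k) = Polynomial.X ^ t 0 := by simp
  rw [this]
  exact (Polynomial.natDegree_C_mul_X_pow_le _ _).trans (by omega)

theorem Pstar_mul_prod_X_add_X_sub_C {F : Type*} [Field F] {P : MvPolynomial (Fin 2) F} {d : ℕ}
    (hd : P.totalDegree ≤ d) (s : Finset F) :
    Pstar (P * ∏ c ∈ s, (X 0 + X 1 - C c)) (d + s.card) =
      Pstar P d * (Polynomial.X + 1) ^ s.card := by
  rw [Pstar, homogeneousComponent_mul_of_totalDegree_le hd (totalDegree_prod_X_add_X_sub_C_le s),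
    homogeneousComponent_prod_X_add_X_sub_C, map_mul, Pstar]
  simp

theorem coeff_Pstar_mul_eq_zero {F : Type*} [Field F] {A B s : Finset F}
    {P : MvPolynomial (Fin 2) F} {d : ℕ} (hd : P.totalDegree ≤ d)
    (hs : ∀ a ∈ A, ∀ b ∈ B, eval ![a, b] P ≠ 0 → a + b ∈ s)
    {i : ℕ} (hiA : i < A.card) (hiB : d + s.card < i + B.card) :
    (Pstar P d * (Polynomial.X + 1) ^ s.card).coeff i = 0 := by
  classical
  rw [← Pstar_mul_prod_X_add_X_sub_C hd s]
  set f : MvPolynomial (Fin 2) F := P * ∏ c ∈ s, (X 0 + X 1 - C c) with hf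
  by_cases hid : i ≤ d + s.card
  swap
  · exact Polynomial.coeff_eq_zero_of_natDegree_lt
      ((natDegree_Pstar_le f _).trans_lt (not_le.mp hid))
  rw [coeff_Pstar f hid]
  by_contra hne
  set t : Fin 2 →₀ ℕ := Finsupp.single 0 i + Finsupp.single 1 (d + s.card - i) with ht
  have htd : t.degree = d + s.card := by
    rw [ht, map_add, Finsupp.degree_single, Finsupp.degree_single]; omega
  have hfd : f.totalDegree = t.degree := by
    refine le_antisymm ?_ ?_
    · rw [htd]
      exact (totalDegree_mul _ _).trans
        (add_le_add hd (totalDegree_prod_X_add_X_sub_C_le s))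
    · rw [Finsupp.degree_apply]
      exact le_totalDegree (mem_support_iff.mpr hne)
  obtain ⟨x, hx, hxe⟩ := combinatorial_nullstellensatz_exists_eval_nonzero f t hne hfd ![A, B] (by
    intro k
    fin_cases k
    · simpa [ht] using hiA
    · simp [ht]; omega)
  have hxv : x = ![x 0, x 1] := by
    ext k
    fin_cases k <;> rfl
  have hP : eval x P ≠ 0 := fun h => hxe (by rw [hf, map_mul, h, zero_mul])
  have hmem : x 0 + x 1 ∈ s := hs _ (hx 0) _ (hx 1) (by rwa [← hxv])
  refine hxe ?_
  rw [hf, map_mul, map_prod, Finset.prod_eq_zero hmem (by simp), mul_zero]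

end BivariateLeadingForm

section GapTheorem

open Polynomial UniqueFactorizationMonoid

theorem natDegree_radical_le_ncard {E : Type*} [Field E] [IsAlgClosed E] [DecidableEq E]
    {P : E[X]} (hP : P ≠ 0) :
    (radical P).natDegree ≤ {α : E | 1 ≤ rootMultiplicity α P}.ncard := by
  have hset : {α : E | 1 ≤ rootMultiplicity α P} = (P.roots.toFinset : Set E) := by
    ext α
    simp [Nat.one_le_iff_ne_zero, hP]
  rw [hset, Set.ncard_coe_finset]
  have hsq := squarefree_radical (a := P)
  have hspl := IsAlgClosed.splits (radical P)
  rw [hspl.natDegree_eq_card_roots]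
  have hnd : (radical P).roots.Nodup := nodup_roots (PerfectField.separable_iff_squarefree.mpr hsq)
  rw [← Multiset.toFinset_card_of_nodup hnd]
  refine Finset.card_le_card fun α hα => ?_
  rw [Multiset.mem_toFinset] at hα ⊢
  exact Multiset.mem_of_le (roots.le_of_dvd hP radical_dvd_self) hα

theorem le_natDegree_add_ncard_of_isCoprime {E : Type*} [Field E] [IsAlgClosed E]
    {P U : E[X]} {l : ℕ} (hl : l ≠ 0) (hcop : IsCoprime P U) (hP : P ≠ 0) (hU : U ≠ 0)
    (hne : P ≠ U) (hdvd : X ^ l ∣ P - U) :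
    l ≤ U.natDegree + {α : E | 1 ≤ rootMultiplicity α P}.ncard ∨
      derivative P = 0 ∧ derivative U = 0 := by
  classical
  obtain ⟨V, hV⟩ := hdvd
  have hV0 : V ≠ 0 := by
    rintro rfl
    exact hne (sub_eq_zero.mp (by rw [hV, mul_zero]))
  have hc : -(P - U) ≠ 0 := neg_ne_zero.mpr (sub_ne_zero.mpr hne)
  rcases Polynomial.abc hP (neg_ne_zero.mpr hU) hc hcop.neg_right (by ring) with h | h
  · left
    have h3 := h.2.2
    rw [natDegree_neg, hV, natDegree_mul (pow_ne_zero _ X_ne_zero) hV0, natDegree_X_pow] at h3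
    have hdv : radical (P * -U * -(X ^ l * V)) ∣ radical P * (U * (X * V)) := by
      have hXV : radical (-(X ^ l * V)) ∣ radical (X ^ l) * radical V := by
        rw [UniqueFactorizationDomain.radical_neg]; exact radical_mul_dvd
      refine (radical_mul_dvd.trans (mul_dvd_mul radical_mul_dvd hXV)).trans ?_
      · rw [mul_assoc]
        refine mul_dvd_mul_left _ (mul_dvd_mul ?_ (mul_dvd_mul ?_ radical_dvd_self))
        · rw [UniqueFactorizationDomain.radical_neg]; exact radical_dvd_self
        · rw [radical_pow _ hl]; exact radical_dvd_self
    have hle := natDegree_le_of_dvd hdv (by simp [hU, hV0])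
    rw [natDegree_mul radical_ne_zero (by simp [hU, hV0]), natDegree_mul hU (by simp [hV0]),
      natDegree_mul X_ne_zero hV0, natDegree_X] at hle
    have := natDegree_radical_le_ncard hP
    omega
  · exact Or.inr ⟨h.1, by simpa using h.2.1⟩

theorem exists_eq_pow_of_derivative_eq_zero {E : Type*} [Field E] [IsAlgClosed E] (p : ℕ)
    [Fact p.Prime] [CharP E p] {P : E[X]} (hP : derivative P = 0) : ∃ Q : E[X], P = Q ^ p := by
  have h := polynomial_expand_eq E p (contract p P)
  rw [expand_contract p hP (Fact.out : p.Prime).ne_zero] at h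
  exact ⟨_, h⟩

theorem rootMultiplicity_pow_of_domain {R : Type*} [CommRing R] [IsDomain R] (P : R[X]) (n : ℕ)
    (a : R) : rootMultiplicity a (P ^ n) = n * rootMultiplicity a P := by
  classical
  rw [← count_roots, ← count_roots, roots_pow, Multiset.count_nsmul]

theorem exists_le_natDegree_add_mul_ncard_of_isCoprime {E : Type*} [Field E] [IsAlgClosed E]
    (p : ℕ) [CharP E p] {P U : E[X]} {l : ℕ} (hcop : IsCoprime P U) (hne : P ≠ U)
    (hdvd : X ^ l ∣ P - U) :
    ∃ q ∈ PPset p, l ≤ U.natDegree + q * {α : E | q ≤ rootMultiplicity α P}.ncard := by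
  induction hn : P.natDegree + U.natDegree using Nat.strong_induction_on generalizing P U l with
  | _ n ih =>
  have hone : 1 ∈ PPset p := by
    unfold PPset
    split_ifs
    · rfl
    · exact ⟨0, rfl⟩
  by_cases hl : l = 0
  · exact ⟨1, hone, by omega⟩
  have hXd : X ∣ P - U := (dvd_pow_self X hl).trans hdvd
  have hP : P ≠ 0 := by
    rintro rfl
    have hu : IsUnit U := isCoprime_zero_left.mp hcop
    exact not_isUnit_X (isUnit_of_dvd_unit (by simpa using hXd) hu)
  have hU : U ≠ 0 := by
    rintro rfl
    have hu : IsUnit P := isCoprime_zero_right.mp hcop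
    exact not_isUnit_X (isUnit_of_dvd_unit (by simpa using hXd) hu)
  rcases le_natDegree_add_ncard_of_isCoprime hl hcop hP hU hne hdvd with h | ⟨hP', hU'⟩
  · exact ⟨1, hone, by simpa using h⟩
  have hpos : P.natDegree + U.natDegree ≠ 0 := by
    intro h0
    apply hne
    have hPc := eq_C_of_natDegree_eq_zero (p := P) (by omega)
    have hUc := eq_C_of_natDegree_eq_zero (p := U) (by omega)
    rw [X_dvd_iff, coeff_sub, sub_eq_zero] at hXd
    rw [hPc, hUc, hXd]
  rcases CharP.char_is_prime_or_zero E p with hp | hp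
  · have : Fact p.Prime := ⟨hp⟩
    obtain ⟨P₁, rfl⟩ := exists_eq_pow_of_derivative_eq_zero p hP'
    obtain ⟨U₁, rfl⟩ := exists_eq_pow_of_derivative_eq_zero p hU'
    rw [natDegree_pow, natDegree_pow] at hn hpos
    have hp0 := hp.pos
    have hlt : P₁.natDegree + U₁.natDegree < n := by
      rw [← mul_add] at hn hpos
      rw [← hn]
      exact lt_mul_of_one_lt_left (Nat.pos_of_ne_zero (right_ne_zero_of_mul hpos)) hp.one_lt
    have hne₁ : P₁ ≠ U₁ := fun h => hne (by rw [h])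
    have hcop₁ : IsCoprime P₁ U₁ :=
      (IsCoprime.pow_iff hp0 hp0).mp hcop
    have hsub : P₁ ^ p - U₁ ^ p = (P₁ - U₁) ^ p := (sub_pow_expChar P₁ U₁).symm
    set l₁ := rootMultiplicity 0 (P₁ - U₁) with hl₁
    have hd₁ : X ^ l₁ ∣ P₁ - U₁ := by
      simpa using pow_rootMultiplicity_dvd (P₁ - U₁) 0
    obtain ⟨q, hq, hle⟩ := ih _ hlt hcop₁ hne₁ hd₁ rfl
    have hll : l ≤ p * l₁ := by
      have h0 : (P₁ - U₁) ^ p ≠ 0 := pow_ne_zero _ (sub_ne_zero.mpr hne₁)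
      have : l ≤ rootMultiplicity 0 ((P₁ - U₁) ^ p) := by
        rw [le_rootMultiplicity_iff h0, ← hsub]
        simpa using hdvd
      rwa [rootMultiplicity_pow_of_domain] at this
    refine ⟨p * q, ?_, ?_⟩
    · rw [PPset, if_neg hp.ne_zero] at hq ⊢
      obtain ⟨k, rfl⟩ := hq
      exact ⟨k + 1, by ring⟩
    · have hset : {α : E | p * q ≤ rootMultiplicity α (P₁ ^ p)} =
          {α : E | q ≤ rootMultiplicity α P₁} := by
        ext α
        simp only [Set.mem_ofPred_eq, rootMultiplicity_pow_of_domain]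
        exact Nat.mul_le_mul_left_iff hp0
      rw [hset, natDegree_pow]
      calc l ≤ p * l₁ := hll
        _ ≤ p * _ := Nat.mul_le_mul_left p hle
        _ = _ := by ring
  · subst hp
    have : CharZero E := CharP.charP_to_charZero E
    exact absurd (by rw [derivative_eq_zero.mp hP',
      derivative_eq_zero.mp hU']) hpos

theorem finite_setOf_le_rootMultiplicity {E : Type*} [Field E] {P : E[X]} (hP : P ≠ 0) {q : ℕ}
    (hq : 1 ≤ q) : {α : E | q ≤ rootMultiplicity α P}.Finite := by
  classical
  refine P.roots.toFinset.finite_toSet.subset fun α hα => ?_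
  have : 0 < rootMultiplicity α P := hq.trans hα
  simpa [hP] using (rootMultiplicity_pos hP).mp this

theorem one_le_of_mem_PPset {p q : ℕ} (hq : q ∈ PPset p) : 1 ≤ q := by
  unfold PPset at hq
  split_ifs at hq with hp
  · exact hq.symm.le
  · obtain ⟨k, rfl⟩ := hq
    exact Nat.one_le_pow _ _ (Nat.pos_of_ne_zero hp)

theorem exists_le_natDegree_add_mul_ncard {E : Type*} [Field E] [IsAlgClosed E]
    (p : ℕ) [CharP E p] {P U : E[X]} {l : ℕ} (hne : P ≠ U) (hP : ¬ X ^ l ∣ P)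
    (hdvd : X ^ l ∣ P - U) :
    ∃ q ∈ PPset p,
      l ≤ U.natDegree + q * {α : E | α ≠ 0 ∧ q ≤ rootMultiplicity α P}.ncard := by
  classical
  have hP0 : P ≠ 0 := fun h => hP (h ▸ dvd_zero _)
  have hU0 : U ≠ 0 := by
    rintro rfl
    exact hP (by simpa using hdvd)
  set G := EuclideanDomain.gcd P U with hG
  obtain ⟨P₁, hGP⟩ : G ∣ P := EuclideanDomain.gcd_dvd_left P U
  obtain ⟨U₁, hGU⟩ : G ∣ U := EuclideanDomain.gcd_dvd_right P U
  have hG0 : G ≠ 0 := fun h => hP0 (by rw [hGP, h, zero_mul])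
  have hP₁0 : P₁ ≠ 0 := fun h => hP0 (by rw [hGP, h, mul_zero])
  have hU₁0 : U₁ ≠ 0 := fun h => hU0 (by rw [hGU, h, mul_zero])
  have hcop : IsCoprime P₁ U₁ := by
    have hab := EuclideanDomain.gcd_eq_gcd_ab P U
    rw [← hG] at hab
    refine ⟨EuclideanDomain.gcdA P U, EuclideanDomain.gcdB P U, mul_left_cancel₀ hG0 ?_⟩
    calc _ = G * P₁ * EuclideanDomain.gcdA P U + G * U₁ * EuclideanDomain.gcdB P U := by ring
      _ = G * 1 := by rw [← hGP, ← hGU, ← hab, mul_one]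
  have hne₁ : P₁ ≠ U₁ := fun h => hne (by rw [hGP, hGU, h])
  obtain ⟨H, hH, hH0⟩ := exists_eq_pow_rootMultiplicity_mul_and_not_dvd G hG0 0
  set m := rootMultiplicity 0 G
  rw [C_0, sub_zero] at hH hH0
  have hml : m < l := by
    by_contra h
    refine hP (((pow_dvd_pow X (not_lt.mp h)).trans ?_).trans (Dvd.intro _ hGP.symm))
    exact Dvd.intro _ hH.symm
  have hdvd₁ : X ^ (l - m) ∣ P₁ - U₁ := by
    have h1 : X ^ m * X ^ (l - m) ∣ X ^ m * (H * (P₁ - U₁)) := by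
      rw [← pow_add, Nat.add_sub_cancel' hml.le, ← mul_assoc, ← hH, mul_sub, ← hGP, ← hGU]
      exact hdvd
    have h2 := (mul_dvd_mul_iff_left (pow_ne_zero m X_ne_zero)).mp h1
    have h3 : IsCoprime (X ^ (l - m)) H :=
      (irreducible_X.coprime_iff_not_dvd.mpr hH0).pow_left
    exact h3.dvd_of_dvd_mul_left h2
  have hP₁X : ¬ X ∣ P₁ := by
    intro h
    have h1 : X ∣ P₁ - U₁ := (dvd_pow_self X (by omega)).trans hdvd₁
    have h2 : X ∣ U₁ := (dvd_sub_right h).mp h1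
    exact not_isUnit_X (hcop.isUnit_of_dvd' h h2)
  obtain ⟨q, hq, hle⟩ := exists_le_natDegree_add_mul_ncard_of_isCoprime p hcop hne₁ hdvd₁
  refine ⟨q, hq, ?_⟩
  have hq1 := one_le_of_mem_PPset hq
  have hcard : {α : E | q ≤ rootMultiplicity α P₁}.ncard ≤
      {α : E | α ≠ 0 ∧ q ≤ rootMultiplicity α P}.ncard := by
    refine Set.ncard_le_ncard ?_ ((finite_setOf_le_rootMultiplicity hP0 hq1).subset
      fun α hα => hα.2)
    intro α hα
    rw [Set.mem_ofPred_eq] at hα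
    refine ⟨?_, ?_⟩
    · rintro rfl
      have h : IsRoot P₁ 0 := (rootMultiplicity_pos hP₁0).mp (hq1.trans hα)
      exact hP₁X (by simpa using dvd_iff_isRoot.mpr h)
    · rw [hGP, rootMultiplicity_mul (hGP ▸ hP0)]
      omega
  have hdeg : m + U₁.natDegree ≤ U.natDegree := by
    rw [hGU, natDegree_mul hG0 hU₁0]
    have hd := natDegree_le_of_dvd (Dvd.intro _ hH.symm : X ^ m ∣ G) hG0
    rw [natDegree_X_pow] at hd
    omega
  have := Nat.mul_le_mul_left q hcard
  omega

end GapTheorem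

section RootCount

open Polynomial

theorem le_NP {F : Type*} [Field F] {R : F[X]} (hR : R ≠ 0) {q : ℕ}
    (hq : q ∈ PPset (ringChar F)) :
    q * {α : AlgebraicClosure F | α ≠ 0 ∧ α ≠ -1 ∧ q ≤ multAC R α}.ncard ≤ NP R := by
  classical
  refine le_csSup ⟨R.natDegree, ?_⟩ ⟨q, hq, rfl⟩
  rintro _ ⟨r, hr, rfl⟩
  set R' := R.map (algebraMap F (AlgebraicClosure F)) with hR'
  have hR0 : R' ≠ 0 := Polynomial.map_ne_zero hR
  have hr1 := one_le_of_mem_PPset hr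
  have hfin : {α | r ≤ rootMultiplicity α R'}.Finite := finite_setOf_le_rootMultiplicity hR0 hr1
  calc r * _ ≤ r * {α | r ≤ rootMultiplicity α R'}.ncard :=
        Nat.mul_le_mul_left r (Set.ncard_le_ncard (fun α hα => hα.2.2) hfin)
    _ = ∑ α ∈ hfin.toFinset, r := by
        rw [Finset.sum_const, smul_eq_mul, mul_comm, Set.ncard_eq_toFinset_card _ hfin]
    _ ≤ ∑ α ∈ hfin.toFinset, R'.roots.count α := by
        refine Finset.sum_le_sum fun α hα => ?_
        rw [count_roots]
        simpa using hα
    _ ≤ R'.roots.card := by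
        rw [← Multiset.toFinset_sum_count_eq]
        refine Finset.sum_le_sum_of_subset fun α hα => ?_
        rw [Multiset.mem_toFinset, ← Multiset.count_pos, count_roots]
        exact hr1.trans (by simpa using hα)
    _ ≤ R'.natDegree := card_roots' R'
    _ = R.natDegree := natDegree_map _

theorem multAC_mul_X_add_one_pow {F : Type*} [Field F] {R : F[X]} (hR : R ≠ 0) (n : ℕ)
    (α : AlgebraicClosure F) :
    multAC (R * (X + 1) ^ n) α = multAC R α + n * rootMultiplicity α (X - C (-1)) := by
  have h0 : R.map (algebraMap F (AlgebraicClosure F)) ≠ 0 := Polynomial.map_ne_zero hR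
  have hX : (X + 1 : (AlgebraicClosure F)[X]) = X - C (-1) := by simp
  rw [multAC, multAC, Polynomial.map_mul, Polynomial.map_pow, Polynomial.map_add, map_X,
    Polynomial.map_one, hX,
    rootMultiplicity_mul (mul_ne_zero h0 (pow_ne_zero _ (X_sub_C_ne_zero _))),
    rootMultiplicity_pow_of_domain]

theorem mul_ncard_le_NP_add_one {F : Type*} [Field F] {R : F[X]} (hR : R ≠ 0) {n : ℕ}
    (hn : ringChar F = 0 ∨ multAC R (-1) + n < ringChar F) {q : ℕ}
    (hq : q ∈ PPset (ringChar F)) :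
    q * {α : AlgebraicClosure F | α ≠ 0 ∧ q ≤ multAC (R * (X + 1) ^ n) α}.ncard ≤ NP R + 1 := by
  classical
  have hq1 := one_le_of_mem_PPset hq
  have hfin : {α : AlgebraicClosure F | α ≠ 0 ∧ α ≠ -1 ∧ q ≤ multAC R α}.Finite :=
    (finite_setOf_le_rootMultiplicity (Polynomial.map_ne_zero hR) hq1).subset fun α hα => hα.2.2
  have hne : ∀ α : AlgebraicClosure F, α ≠ -1 →
      multAC (R * (X + 1) ^ n) α = multAC R α := fun α hα => by
    rw [multAC_mul_X_add_one_pow hR, rootMultiplicity_X_sub_C, if_neg hα, mul_zero, add_zero]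
  have hself : multAC (R * (X + 1) ^ n) (-1) = multAC R (-1) + n := by
    rw [multAC_mul_X_add_one_pow hR, rootMultiplicity_X_sub_C_self, mul_one]
  have hNP := le_NP hR hq
  by_cases hq2 : q = 1
  · subst hq2
    have hsub : {α : AlgebraicClosure F | α ≠ 0 ∧ 1 ≤ multAC (R * (X + 1) ^ n) α} ⊆
        insert (-1) {α : AlgebraicClosure F | α ≠ 0 ∧ α ≠ -1 ∧ 1 ≤ multAC R α} := by
      rintro α ⟨h0, hα⟩
      by_cases h : α = -1
      · exact Or.inl h
      · exact Or.inr ⟨h0, h, hne α h ▸ hα⟩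
    have h1 := Set.ncard_le_ncard hsub (hfin.insert _)
    have h2 := Set.ncard_insert_le (-1)
      {α : AlgebraicClosure F | α ≠ 0 ∧ α ≠ -1 ∧ 1 ≤ multAC R α}
    omega
  · have hqn : multAC R (-1) + n < q := by
      unfold PPset at hq
      split_ifs at hq with hp
      · exact absurd hq hq2
      · obtain ⟨k, rfl⟩ := hq
        have hk : k ≠ 0 := by
          rintro rfl
          exact hq2 (pow_zero _)
        exact (hn.resolve_left hp).trans_le (Nat.le_pow (Nat.pos_of_ne_zero hk))
    have hsub : {α : AlgebraicClosure F | α ≠ 0 ∧ q ≤ multAC (R * (X + 1) ^ n) α} ⊆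
        {α : AlgebraicClosure F | α ≠ 0 ∧ α ≠ -1 ∧ q ≤ multAC R α} := by
      rintro α ⟨h0, hα⟩
      have h : α ≠ -1 := by
        rintro rfl
        rw [hself] at hα
        omega
      exact ⟨h0, h, hne α h ▸ hα⟩
    have h1 := Nat.mul_le_mul_left q (Set.ncard_le_ncard hsub hfin)
    omega

theorem le_add_card_add_NP {F : Type*} [Field F] {R : F[X]} {a b d n : ℕ}
    (hn : ringChar F = 0 ∨ multAC R (-1) + n < ringChar F)
    (hi : ∃ i < a, R.coeff i ≠ 0) (hj : ∃ j < b, j ≤ d ∧ R.coeff (d - j) ≠ 0)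
    (hgap : ∀ i < a, d + n < i + b → (R * (X + 1) ^ n).coeff i = 0) :
    a + b ≤ d + n + NP R + 1 := by
  classical
  obtain ⟨i, hia, hi⟩ := hi
  obtain ⟨j, hjb, hjd, hj⟩ := hj
  have hR : R ≠ 0 := by
    rintro rfl
    exact hi (coeff_zero i)
  set f := algebraMap F (AlgebraicClosure F)
  have hX : (X + 1 : F[X]) = X + C 1 := by simp
  have hXn : ((X + 1 : F[X]) ^ n).natDegree = n := by
    rw [hX, natDegree_pow, natDegree_X_add_C, mul_one]
  have hX0 : (X + 1 : F[X]) ^ n ≠ 0 := by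
    rw [hX]
    exact pow_ne_zero _ (X_add_C_ne_zero 1)
  set S := R * (X + 1) ^ n with hS
  set Q := S.map f with hQ
  have hXQ : ¬ X ^ a ∣ Q := by
    intro h
    have hSa : X ^ a ∣ S := by
      rw [X_pow_dvd_iff] at h ⊢
      intro k hk
      have := h k hk
      rwa [hQ, coeff_map, map_eq_zero] at this
    have hcop : IsCoprime (X ^ a) ((X + 1 : F[X]) ^ n) :=
      IsCoprime.pow ⟨-1, 1, by ring⟩
    exact hi (X_pow_dvd_iff.mp (hcop.dvd_of_dvd_mul_right hSa) i hia)
  set U := Q %ₘ X ^ a with hU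
  have hdvd : X ^ a ∣ Q - U := ⟨Q /ₘ X ^ a, by
    rw [sub_eq_iff_eq_add, add_comm]
    exact (modByMonic_add_div Q (X ^ a)).symm⟩
  have hU0 : U ≠ 0 := fun h => hXQ (by simpa [h] using hdvd)
  have hUa : U.natDegree < a := by
    have := degree_modByMonic_lt Q (monic_X_pow (R := AlgebraicClosure F) a)
    rw [degree_X_pow, degree_eq_natDegree hU0] at this
    exact_mod_cast this
  have hUb : U.natDegree + b ≤ d + n := by
    by_contra h
    have hz := hgap _ hUa (not_le.mp h)
    have hc := X_pow_dvd_iff.mp hdvd _ hUa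
    rw [coeff_sub, hQ, coeff_map, hz, map_zero, zero_sub, neg_eq_zero] at hc
    exact hU0 (leadingCoeff_eq_zero.mp hc)
  have hne : Q ≠ U := by
    intro h
    have h1 : Q.natDegree = R.natDegree + n := by
      rw [hQ, natDegree_map, hS, natDegree_mul hR hX0, hXn]
    have h2 := le_natDegree_of_ne_zero hj
    rw [← h, h1] at hUb
    omega
  have : CharP (AlgebraicClosure F) (ringChar F) := charP_of_injective_algebraMap f.injective _
  obtain ⟨q, hq, hle⟩ := exists_le_natDegree_add_mul_ncard (ringChar F) hne hXQ hdvd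
  have := mul_ncard_le_NP_add_one hR hn hq
  change q * {α | α ≠ 0 ∧ q ≤ rootMultiplicity α Q}.ncard ≤ _ at this
  omega

end RootCount

/-- Theorem 1: Let `F` be a field of characteristic `p` (with `p = ∞`,
i.e. `⊤ : ℕ∞`, when `char F = 0`), `A, B` finite nonempty subsets of `F`, and `P(x,y)` a
polynomial over `F` of total degree `d` such that `P̂(i, d−i) ≠ 0` for some
`0 ≤ i ≤ |A|−1` and `P̂(d−j, j) ≠ 0` for some `0 ≤ j ≤ |B|−1`.  With
`P*(x) = P₀(x,1)` (`P₀` the degree-`d` homogeneous part of `P`) and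
`C = {a+b : a ∈ A, b ∈ B, P(a,b) ≠ 0}`, we have
`|C| ≥ min{p − m_{P*}(−1), |A| + |B| − 1 − d − N(P*)}`. -/
theorem card_restricted_sumset_polynomial {F : Type*} [Field F]
    (A B : Finset F) (hA : A.Nonempty) (hB : B.Nonempty)
    (P : MvPolynomial (Fin 2) F) (d : ℕ) (hd : P.totalDegree = d)
    (hi : ∃ i < A.card,
      MvPolynomial.coeff (Finsupp.single 0 i + Finsupp.single 1 (d - i)) P ≠ 0)
    (hj : ∃ j < B.card,
      MvPolynomial.coeff (Finsupp.single 0 (d - j) + Finsupp.single 1 j) P ≠ 0) :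
    min ((if ringChar F = 0 then (⊤ : ℕ∞) else (ringChar F : ℕ∞))
          - (multAC (Pstar P d) (-1) : ℕ∞))
        ((A.card : ℕ∞) + (B.card : ℕ∞) - 1 - (d : ℕ∞) - (NP (Pstar P d) : ℕ∞))
      ≤ ({c : F | ∃ a ∈ A, ∃ b ∈ B, MvPolynomial.eval ![a, b] P ≠ 0 ∧ a + b = c}.ncard
          : ℕ∞) := by
  classical
  set R := Pstar P d with hR
  set c : Set F := {c : F | ∃ a ∈ A, ∃ b ∈ B, MvPolynomial.eval ![a, b] P ≠ 0 ∧ a + b = c} with hc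
  have hcfin : c.Finite := by
    refine (Finset.image₂ (· + ·) A B).finite_toSet.subset ?_
    rintro _ ⟨a, ha, b, hb, -, rfl⟩
    exact Finset.mem_coe.mpr (Finset.mem_image₂_of_mem ha hb)
  have hcard : c.ncard = hcfin.toFinset.card := Set.ncard_eq_toFinset_card c hcfin
  have hle : ∀ t, P.coeff t ≠ 0 → t.degree ≤ d := fun t ht => by
    rw [← hd, Finsupp.degree_apply]
    exact MvPolynomial.le_totalDegree (MvPolynomial.mem_support_iff.mpr ht)
  by_contra! hlt
  rw [lt_min_iff] at hlt
  obtain ⟨hlt₁, hlt₂⟩ := hlt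
  have hn : ringChar F = 0 ∨ multAC R (-1) + c.ncard < ringChar F := by
    by_cases hp : ringChar F = 0
    · exact Or.inl hp
    · right
      rw [if_neg hp] at hlt₁
      have : c.ncard < ringChar F - multAC R (-1) := by exact_mod_cast hlt₁
      omega
  have hbound : c.ncard < A.card + B.card - 1 - d - NP R := by exact_mod_cast hlt₂
  have hmain : A.card + B.card ≤ d + c.ncard + NP R + 1 := by
    refine le_add_card_add_NP hn ?_ ?_ ?_
    · obtain ⟨i, hiA, hi⟩ := hi
      have := hle _ hi
      rw [map_add, Finsupp.degree_single, Finsupp.degree_single] at this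
      exact ⟨i, hiA, by rwa [hR, coeff_Pstar P (by omega)]⟩
    · obtain ⟨j, hjB, hj⟩ := hj
      have := hle _ hj
      rw [map_add, Finsupp.degree_single, Finsupp.degree_single] at this
      have hjd : j ≤ d := by omega
      refine ⟨j, hjB, hjd, ?_⟩
      rwa [hR, coeff_Pstar P (Nat.sub_le d j), Nat.sub_sub_self hjd]
    · intro i hiA hiB
      rw [hcard] at hiB ⊢
      refine coeff_Pstar_mul_eq_zero hd.le (fun a ha b hb h => ?_) hiA hiB
      exact hcfin.mem_toFinset.mpr ⟨a, ha, b, hb, h, rfl⟩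
  omega
end

section
/- Let P(x) be a polynomial over a field F of characteristic p (with the convention p = ∞ if F has characteristic zero). Suppose there exist nonnegative integers k < l such that the coefficient of x^i in P(x) vanishes for every integer i with k < i < l. Then at least one of the following holds: (a) x^l divides P(x); (b) deg P(x) ≤ k; (c) N_q(P) ≥ l − k for some q ∈ 𝒫(p). -/
/-- `N_q(P) = q·|{α ∈ E^× : m_P(α) ≥ q}| − Σ_{α ∈ E^×} (m_P(α) mod q)`, where `E` is the
algebraic closure of `F` and `E^× = E \ {0}`. -/
noncomputable def Nq {F : Type*} [Field F] (P : Polynomial F) (q : ℕ) : ℤ :=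
  (q : ℤ) * ({α : AlgebraicClosure F | α ≠ 0 ∧ q ≤ multAC P α}.ncard : ℤ)
    - ∑ᶠ α ∈ {α : AlgebraicClosure F | α ≠ 0}, ((multAC P α % q : ℕ) : ℤ)

/-- The contribution of a nonzero root of multiplicity `m` to `N_q`. -/
def rootWeight (q m : ℕ) : ℤ := (if q ≤ m then (q : ℤ) else 0) - ((m % q : ℕ) : ℤ)

lemma rootWeight_mul {p : ℕ} (hp : 0 < p) (q m : ℕ) :
    rootWeight (p * q) m = p * rootWeight q (m / p) - ((m % p : ℕ) : ℤ) := by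
  have h : p * q ≤ m ↔ q ≤ m / p := by rw [Nat.le_div_iff_mul_le hp, mul_comm]
  simp only [rootWeight, h, Nat.mod_mul]
  split_ifs <;> push_cast <;> ring

open Polynomial in
/-- A polynomial identity for the logarithmic derivative, with denominators cleared. -/
lemma exists_prod_mul_X_mul_derivative {E : Type*} [Field E] (T : Finset E) (c : E)
    (s : Multiset E) (hs : ∀ β ∈ s, β ≠ 0 → β ∈ T) :
    ∃ S : E[X], S.natDegree ≤ T.card ∧
      (∏ α ∈ T, (X - C α)) * X * derivative (C c * (s.map fun β => X - C β).prod) =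
        S * (C c * (s.map fun β => X - C β).prod) := by
  classical
  induction s using Multiset.induction with
  | empty => exact ⟨0, by simp, by simp⟩
  | cons β s ih =>
    obtain ⟨S, hS, h⟩ := ih fun γ hγ => hs γ (Multiset.mem_cons_of_mem hγ)
    obtain ⟨S', hS', h'⟩ : ∃ S' : E[X], S'.natDegree ≤ T.card ∧
        (∏ α ∈ T, (X - C α)) * X = (X - C β) * S' := by
      by_cases hβ : β = 0
      · exact ⟨∏ α ∈ T, (X - C α), by rw [natDegree_finsetProd_X_sub_C_eq_card], by
          rw [hβ]; simp [mul_comm]⟩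
      · have hT := hs β (Multiset.mem_cons_self β s) hβ
        refine ⟨(∏ α ∈ T.erase β, (X - C α)) * X, ?_, ?_⟩
        · refine natDegree_mul_le.trans ?_
          rw [natDegree_finsetProd_X_sub_C_eq_card, natDegree_X, Finset.card_erase_add_one hT]
        · rw [← Finset.mul_prod_erase T _ hT, mul_assoc]
    refine ⟨S + S', (natDegree_add_le _ _).trans (max_le hS hS'), ?_⟩
    rw [Multiset.map_cons, Multiset.prod_cons]
    have e : C c * ((X - C β) * (s.map fun β => X - C β).prod) =
        (X - C β) * (C c * (s.map fun β => X - C β).prod) := by ring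
    rw [e]
    generalize C c * (s.map fun β => X - C β).prod = Q at h ⊢
    rw [derivative_mul, derivative_X_sub_C]
    linear_combination (X - C β) * h + Q * h'

open Polynomial in
/-- If `A + B` has few nonzero roots compared with the gap between `A` and `B`, then `A` and `B`
have vanishing Wronskian. -/
lemma derivative_mul_eq_of_gap {E : Type*} [Field E] [IsAlgClosed E] {A B : E[X]} {k l : ℕ}
    (hA : A.natDegree ≤ k) (hB : X ^ l ∣ B) (T : Finset E)
    (hT : ∀ β ∈ (A + B).roots, β ≠ 0 → β ∈ T) (h : k + T.card < l) :
    A * derivative B = derivative A * B := by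
  obtain ⟨S, hS, hP⟩ := exists_prod_mul_X_mul_derivative T (A + B).leadingCoeff _ hT
  rw [← (IsAlgClosed.splits (A + B)).eq_prod_roots] at hP
  have hR0 : (∏ α ∈ T, (X - C α)) * X ≠ 0 :=
    mul_ne_zero (Finset.prod_ne_zero_iff.2 fun α _ => X_sub_C_ne_zero α) X_ne_zero
  have hRdeg : (∏ α ∈ T, (X - C α)).natDegree = T.card :=
    by simp
  generalize (∏ α ∈ T, (X - C α)) = R at hP hR0 hRdeg
  have hXB : X ^ l ∣ X * derivative B := by
    obtain ⟨Q, rfl⟩ := hB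
    rw [derivative_mul, derivative_X_pow]
    cases l with
    | zero => simp
    | succ l => exact ⟨C ((l + 1 : ℕ) : E) * Q + X * derivative Q, by
        simp only [Nat.add_sub_cancel]; ring⟩
  have hlow : R * X * derivative A - S * A = 0 := by
    refine eq_zero_of_dvd_of_natDegree_lt (p := X ^ l) ?_ ?_
    · have e : R * X * derivative A - S * A = S * B - R * (X * derivative B) := by
        rw [derivative_add] at hP
        linear_combination hP
      rw [e]
      exact dvd_sub (hB.mul_left _) (hXB.mul_left _)
    · rw [natDegree_X_pow]
      refine lt_of_le_of_lt ((natDegree_sub_le _ _).trans (max_le ?_ ?_)) h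
      · rcases eq_or_ne (derivative A) 0 with h0 | h0
        · simp [h0]
        · have hlt : (derivative A).natDegree < A.natDegree :=
            natDegree_derivative_lt fun h1 => h0 (derivative_of_natDegree_zero h1)
          have h1 := natDegree_mul_le (p := R * X) (q := derivative A)
          have h2 := natDegree_mul_le (p := R) (q := X)
          rw [natDegree_X] at h2
          omega
      · exact natDegree_mul_le.trans (by omega)
  refine mul_left_cancel₀ hR0 ?_
  rw [derivative_add] at hP
  linear_combination A * hP - (A + B) * hlow

open Polynomial in
/-- Polynomials with vanishing Wronskian have the same multiplicities in the base field. -/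
lemma rootMultiplicity_cast_eq_of_derivative_mul_eq {E : Type*} [Field E] {A B : E[X]}
    (hA : A ≠ 0) (hB : B ≠ 0) (h : A * derivative B = derivative A * B) (α : E) :
    (rootMultiplicity α A : E) = rootMultiplicity α B := by
  obtain ⟨A₁, hA₁, hA₂⟩ := exists_eq_pow_rootMultiplicity_mul_and_not_dvd A hA α
  obtain ⟨B₁, hB₁, hB₂⟩ := exists_eq_pow_rootMultiplicity_mul_and_not_dvd B hB α
  generalize rootMultiplicity α A = a at *
  generalize rootMultiplicity α B = b at *
  have key : ∀ (n : ℕ) (Q : E[X]), (X - C α) * derivative ((X - C α) ^ n * Q) =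
      (X - C α) ^ n * (C (n : E) * Q + (X - C α) * derivative Q) := by
    intro n Q
    rw [derivative_mul, derivative_pow, derivative_X_sub_C]
    cases n with
    | zero => simp
    | succ n => simp only [Nat.add_sub_cancel]; ring
  have hX := X_sub_C_ne_zero α
  have e : A₁ * (C (b : E) * B₁ + (X - C α) * derivative B₁) =
      B₁ * (C (a : E) * A₁ + (X - C α) * derivative A₁) := by
    refine mul_left_cancel₀ (mul_ne_zero (pow_ne_zero a hX) (pow_ne_zero b hX)) ?_
    have kA := key a A₁
    have kB := key b B₁
    rw [← hA₁] at kA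
    rw [← hB₁] at kB
    calc _ = ((X - C α) ^ a * A₁) * ((X - C α) ^ b *
          (C (b : E) * B₁ + (X - C α) * derivative B₁)) := by ring
      _ = ((X - C α) ^ b * B₁) * ((X - C α) ^ a *
          (C (a : E) * A₁ + (X - C α) * derivative A₁)) := by
        rw [← kA, ← kB, ← hA₁, ← hB₁]
        linear_combination (X - C α) * h
      _ = _ := by ring
  rw [dvd_iff_isRoot, IsRoot.def] at hA₂ hB₂
  have e' := congrArg (eval α) e
  simp only [eval_mul, eval_add, eval_C, eval_sub, eval_X, sub_self, zero_mul, add_zero] at e'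
  refine mul_left_cancel₀ (mul_ne_zero hA₂ hB₂) ?_
  linear_combination -e'

open Polynomial in
lemma rootMultiplicity_C_mul_prod {E : Type*} [Field E] {c : E} (hc : c ≠ 0) (T : Finset E)
    (n : E → ℕ) (hn : ∀ α ∉ T, n α = 0) (α : E) :
    rootMultiplicity α (C c * ∏ β ∈ T, (X - C β) ^ n β) = n α := by
  classical
  have h0 : ∏ β ∈ T, (X - C β) ^ n β ≠ 0 :=
    Finset.prod_ne_zero_iff.2 fun β _ => pow_ne_zero _ (X_sub_C_ne_zero β)
  rw [← count_roots, roots_C_mul _ hc, roots_prod _ _ h0, Multiset.count_bind]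
  simp only [roots_pow, roots_X_sub_C, Multiset.count_nsmul, Multiset.count_singleton]
  change ∑ β ∈ T, (n β * if α = β then 1 else 0) = n α
  simp only [mul_ite, mul_one, mul_zero, Finset.sum_ite_eq]
  split_ifs with h
  · rfl
  · exact (hn α h).symm

open Polynomial in
lemma eq_C_mul_prod_pow_rootMultiplicity {E : Type*} [Field E] [IsAlgClosed E] {A : E[X]}
    (T : Finset E) (hT : ∀ α ∈ A.roots, α ∈ T) :
    A = C A.leadingCoeff * ∏ α ∈ T, (X - C α) ^ rootMultiplicity α A := by
  classical
  conv_lhs => rw [(IsAlgClosed.splits A).eq_prod_roots, prod_multiset_root_eq_finset_root]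
  congr 1
  refine Finset.prod_subset (fun α hα => hT α (Multiset.mem_toFinset.1 hα)) fun α _ hα => ?_
  rw [← count_roots, Multiset.count_eq_zero_of_notMem (by simpa using hα), pow_zero]

open Polynomial in
/-- Splitting off the `p`-th power part of a polynomial. -/
lemma exists_eq_prod_mul_pow {E : Type*} [Field E] [IsAlgClosed E] {p : ℕ} (hp : 0 < p)
    {A : E[X]} (hA : A ≠ 0) (T : Finset E) (hT : ∀ α ∈ A.roots, α ∈ T) (n : E → ℕ)
    (hn : ∀ α, rootMultiplicity α A % p = n α) :
    ∃ A₁ : E[X], A = (∏ α ∈ T, (X - C α) ^ n α) * A₁ ^ p ∧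
      ∀ α, rootMultiplicity α A₁ = rootMultiplicity α A / p := by
  classical
  obtain ⟨c, hc⟩ := IsAlgClosed.exists_pow_nat_eq A.leadingCoeff hp
  have hc0 : c ≠ 0 := by
    rintro rfl
    rw [zero_pow hp.ne'] at hc
    exact leadingCoeff_ne_zero.2 hA hc.symm
  refine ⟨C c * ∏ α ∈ T, (X - C α) ^ (rootMultiplicity α A / p), ?_, ?_⟩
  · conv_lhs => rw [eq_C_mul_prod_pow_rootMultiplicity T hT]
    rw [mul_pow, ← C_pow, hc, mul_left_comm, ← Finset.prod_pow, ← Finset.prod_mul_distrib]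
    congr 1
    refine Finset.prod_congr rfl fun α _ => ?_
    rw [← pow_mul, ← pow_add, ← hn α, mul_comm (_ / p), Nat.mod_add_div]
  · refine rootMultiplicity_C_mul_prod hc0 T _ fun α hα => ?_
    rw [← count_roots, Multiset.count_eq_zero_of_notMem fun h => hα (hT α h), Nat.zero_div]

open Polynomial in
lemma natDegree_lt_natDegree_of_gap {E : Type*} [Field E] {A B : E[X]} {k l : ℕ}
    (hkl : k < l) (hB0 : B ≠ 0) (hA : A.natDegree ≤ k) (hB : X ^ l ∣ B) :
    A.natDegree < B.natDegree := by
  have := natDegree_le_of_dvd hB hB0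
  rw [natDegree_X_pow] at this
  omega

open Polynomial in
lemma gap_le_sum_rootWeight_one {E : Type*} [Field E] [IsAlgClosed E] {A B : E[X]} {k l : ℕ}
    (hA : A.natDegree ≤ k) (hB : X ^ l ∣ B)
    (hW : A * derivative B ≠ derivative A * B) (T : Finset E)
    (hT : ∀ α ∈ (A + B).roots, α ≠ 0 → α ∈ T) :
    (l : ℤ) - k ≤ ∑ α ∈ T, rootWeight 1 (rootMultiplicity α (A + B)) := by
  classical
  have h := mt (derivative_mul_eq_of_gap hA hB (T.filter fun α => α ∈ (A + B).roots)
    fun β hβ h0 => Finset.mem_filter.2 ⟨hT β hβ h0, hβ⟩) hW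
  have e : ∑ α ∈ T, rootWeight 1 (rootMultiplicity α (A + B)) =
      ((T.filter fun α => α ∈ (A + B).roots).card : ℤ) := by
    rw [Finset.card_filter]
    push_cast
    refine Finset.sum_congr rfl fun α _ => ?_
    have : 1 ≤ rootMultiplicity α (A + B) ↔ α ∈ (A + B).roots := by
      rw [← count_roots, Multiset.one_le_count_iff_mem]
    simp only [rootWeight, this, Nat.mod_one]
    simp
  rw [e]
  omega

open Polynomial in
lemma natDegree_eq_of_derivative_mul_eq {E : Type*} [Field E] [IsAlgClosed E] [CharZero E]
    {A B : E[X]} (hA : A ≠ 0) (hB : B ≠ 0) (h : A * derivative B = derivative A * B) :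
    A.natDegree = B.natDegree := by
  classical
  have hr : A.roots = B.roots := Multiset.ext.2 fun α => by
    rw [count_roots, count_roots]
    exact_mod_cast rootMultiplicity_cast_eq_of_derivative_mul_eq hA hB h α
  rw [(IsAlgClosed.splits A).natDegree_eq_card_roots, hr,
    (IsAlgClosed.splits B).natDegree_eq_card_roots]

open Polynomial in
lemma exists_gap_le_sum_rootWeight {E : Type*} [Field E] [IsAlgClosed E] (p : ℕ)
    [hp : Fact p.Prime] [CharP E p] (A B : E[X]) (k l : ℕ) (hkl : k < l) (hA0 : A ≠ 0)
    (hB0 : B ≠ 0) (hA : A.natDegree ≤ k) (hB : X ^ l ∣ B) :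
    ∃ e : ℕ, ∀ T : Finset E, 0 ∉ T → (∀ α ∈ (A + B).roots, α ≠ 0 → α ∈ T) →
      (l : ℤ) - k ≤ ∑ α ∈ T, rootWeight (p ^ e) (rootMultiplicity α (A + B)) := by
  classical
  induction hN : B.natDegree using Nat.strong_induction_on generalizing A B k l with
  | _ N ih =>
  have hdeg := natDegree_lt_natDegree_of_gap hkl hB0 hA hB
  have hP0 : A + B ≠ 0 := by
    intro h
    rw [eq_neg_of_add_eq_zero_left h, natDegree_neg] at hdeg
    exact hdeg.false
  by_cases hW : A * derivative B = derivative A * B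
  swap
  · exact ⟨0, fun T _ hT => by
      rw [pow_zero]; exact gap_le_sum_rootWeight_one hA hB hW T hT⟩
  have hp0 := hp.out.pos
  have hmod : ∀ {Q R : E[X]}, Q ≠ 0 → R ≠ 0 → Q * derivative R = derivative Q * R →
      ∀ α, rootMultiplicity α Q % p = rootMultiplicity α R % p := fun hQ hR h α =>
    (CharP.natCast_eq_natCast E p).1 (rootMultiplicity_cast_eq_of_derivative_mul_eq hQ hR h α)
  have hAP := hmod hA0 hP0 (by rw [derivative_add]; linear_combination hW)
  have hBP := hmod hB0 hP0 (by rw [derivative_add]; linear_combination -hW)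
  let n : E → ℕ := fun α => rootMultiplicity α (A + B) % p
  let T₀ : Finset E := insert 0 (A.roots + B.roots + (A + B).roots).toFinset
  have hmem : ∀ α, α ∈ A.roots ∨ α ∈ B.roots ∨ α ∈ (A + B).roots → α ∈ T₀ := fun α h =>
    Finset.mem_insert_of_mem <| Multiset.mem_toFinset.2 <| by
      simpa only [Multiset.mem_add, or_assoc] using h
  obtain ⟨A₁, hA₁, -⟩ := exists_eq_prod_mul_pow hp0 hA0 T₀ (fun α h => hmem α (.inl h)) n hAP
  obtain ⟨B₁, hB₁, mB₁⟩ :=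
    exists_eq_prod_mul_pow hp0 hB0 T₀ (fun α h => hmem α (.inr (.inl h))) n hBP
  obtain ⟨V, hV, mV⟩ :=
    exists_eq_prod_mul_pow hp0 hP0 T₀ (fun α h => hmem α (.inr (.inr h))) n fun _ => rfl
  have hU : ∏ α ∈ T₀, (X - C α) ^ n α ≠ 0 :=
    Finset.prod_ne_zero_iff.2 fun β _ => pow_ne_zero _ (X_sub_C_ne_zero β)
  have hdU : (∏ α ∈ T₀, (X - C α) ^ n α).natDegree = n 0 + ∑ α ∈ T₀.erase 0, n α := by
    rw [natDegree_prod _ _ fun β _ => pow_ne_zero _ (X_sub_C_ne_zero β),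
      Finset.add_sum_erase _ _ (Finset.mem_insert_self _ _)]
    exact Finset.sum_congr rfl fun α _ => by rw [natDegree_pow, natDegree_X_sub_C, mul_one]
  obtain rfl : V = A₁ + B₁ := by
    refine frobenius_inj E[X] p (mul_left_cancel₀ hU ?_)
    rw [frobenius_def, frobenius_def, add_pow_char, mul_add, ← hA₁, ← hB₁, ← hV]
  have hA₁0 : A₁ ≠ 0 := by
    rintro rfl
    exact hA0 (by rw [hA₁, zero_pow hp0.ne', mul_zero])
  have hB₁0 : B₁ ≠ 0 := by
    rintro rfl
    exact hB0 (by rw [hB₁, zero_pow hp0.ne', mul_zero])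
  have hdA := congrArg natDegree hA₁
  have hdB := congrArg natDegree hB₁
  rw [natDegree_mul hU (pow_ne_zero _ hA₁0), natDegree_pow, hdU] at hdA
  rw [natDegree_mul hU (pow_ne_zero _ hB₁0), natDegree_pow, hdU] at hdB
  have hl : l ≤ n 0 + p * rootMultiplicity 0 B₁ := by
    have h0 : n 0 = rootMultiplicity 0 B % p := (hBP 0).symm
    rw [mB₁, h0, Nat.mod_add_div]
    exact (le_rootMultiplicity_iff hB0).2 (by simpa using hB)
  have hlt : A₁.natDegree < rootMultiplicity 0 B₁ :=
    lt_of_mul_lt_mul_left (a := p) (by omega) hp0.le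
  have hdvd : X ^ rootMultiplicity 0 B₁ ∣ B₁ := by
    simpa using pow_rootMultiplicity_dvd B₁ 0
  have hdeg₁ := natDegree_lt_natDegree_of_gap hlt hB₁0 le_rfl hdvd
  have hdlt : B₁.natDegree < N := by
    have := Nat.mul_le_mul_right B₁.natDegree hp.out.two_le
    omega
  obtain ⟨e, he⟩ := ih _ hdlt A₁ B₁ _ _ hlt hA₁0 hB₁0 le_rfl hdvd rfl
  refine ⟨e + 1, fun T hT0 hT => ?_⟩
  have hsum := he T hT0 fun α hα h0 => hT α (by
    rw [mem_roots hP0, hV, IsRoot.def, eval_mul, eval_pow, (isRoot_of_mem_roots hα).eq_zero,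
      zero_pow hp0.ne', mul_zero]) h0
  have hn : ∑ α ∈ T, n α ≤ ∑ α ∈ T₀.erase 0, n α := by
    refine Finset.sum_le_sum_of_ne_zero fun α hα h => Finset.mem_erase.2 ⟨?_, hmem α ?_⟩
    · rintro rfl
      exact hT0 hα
    · refine .inr (.inr (by_contra fun h' => h ?_))
      simp only [n]
      rw [← count_roots, Multiset.count_eq_zero_of_notMem h', Nat.zero_mod]
  have hval : ∑ α ∈ T, rootWeight (p ^ (e + 1)) (rootMultiplicity α (A + B)) =
      p * ∑ α ∈ T, rootWeight (p ^ e) (rootMultiplicity α (A₁ + B₁)) -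
        ((∑ α ∈ T, n α : ℕ) : ℤ) := by
    rw [Finset.mul_sum, Nat.cast_sum, ← Finset.sum_sub_distrib]
    refine Finset.sum_congr rfl fun α _ => ?_
    rw [pow_succ', rootWeight_mul hp0, mV]
  rw [hval]
  have hmul := mul_le_mul_of_nonneg_left hsum (Int.natCast_nonneg p)
  rw [mul_sub] at hmul
  zify at hl hn hdA hA ⊢
  linarith

open Polynomial in
lemma Nq_eq_sum_rootWeight {F : Type*} [Field F] [DecidableEq (AlgebraicClosure F)] {P : F[X]}
    {q : ℕ} (hq : 0 < q) :
    Nq P q = ∑ α ∈ (P.map (algebraMap F (AlgebraicClosure F))).roots.toFinset.erase 0,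
      rootWeight q (rootMultiplicity α (P.map (algebraMap F (AlgebraicClosure F)))) := by
  have hmem : ∀ α, multAC P α ≠ 0 →
      α ∈ (P.map (algebraMap F (AlgebraicClosure F))).roots := fun α h => by
    rwa [multAC, ← count_roots, Multiset.count_ne_zero] at h
  simp only [rootWeight, Finset.sum_sub_distrib, Nq]
  congr 1
  · have hset : {α : AlgebraicClosure F | α ≠ 0 ∧ q ≤ multAC P α} =
        (((P.map (algebraMap F (AlgebraicClosure F))).roots.toFinset.erase 0).filter
          fun α => q ≤ multAC P α : Finset (AlgebraicClosure F)) := by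
      ext α
      simp only [Set.mem_ofPred_eq, Finset.coe_filter, Finset.mem_erase, Multiset.mem_toFinset]
      exact ⟨fun h => ⟨⟨h.1, hmem α (by omega)⟩, h.2⟩, fun h => ⟨h.1.1, h.2⟩⟩
    rw [hset, Set.ncard_coe_finset, ← Finset.sum_filter, Finset.sum_const, nsmul_eq_mul, mul_comm]
    rfl
  · refine finsum_mem_eq_sum_of_inter_support_eq _ ?_
    ext α
    simp only [Set.mem_inter_iff, Set.mem_ofPred_eq, Function.mem_support, Finset.coe_erase,
      Set.mem_sdiff, Finset.mem_coe, Multiset.mem_toFinset, Set.mem_singleton_iff]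
    refine ⟨fun h => ⟨⟨hmem α fun h0 => h.2 ?_, h.1⟩, h.2⟩, fun h => ⟨h.1.2, h.2⟩⟩
    rw [h0, Nat.zero_mod, Nat.cast_zero]

open Polynomial in
lemma exists_gap_decomposition {R : Type*} [CommRing R] (P : R[X]) (k l : ℕ)
    (hcoeff : ∀ i : ℕ, k < i → i < l → P.coeff i = 0) :
    ∃ A B : R[X], P = A + B ∧ A.natDegree ≤ k ∧ X ^ l ∣ B := by
  refine ⟨∑ i ∈ Finset.range (k + 1), monomial i (P.coeff i),
    P - ∑ i ∈ Finset.range (k + 1), monomial i (P.coeff i), by ring, ?_, ?_⟩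
  · refine natDegree_sum_le_of_forall_le _ _ fun i hi => (natDegree_monomial_le _).trans ?_
    exact Nat.lt_succ_iff.1 (Finset.mem_range.1 hi)
  · refine X_pow_dvd_iff.2 fun i hi => ?_
    simp only [coeff_sub, finsetSum_coeff, coeff_monomial, Finset.sum_ite_eq', Finset.mem_range]
    split_ifs with h
    · exact sub_self _
    · rw [sub_zero, hcoeff i (by omega) hi]

/-- Lemma 1: Let `P(x)` be a polynomial over a field `F` of characteristic
`p` and suppose the coefficient of `x^i` in `P` vanishes for all `k < i < l` (where
`0 ≤ k < l`).  Then `x^l ∣ P(x)`, or `deg P ≤ k`, or `N_q(P) ≥ l − k` for some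
`q ∈ 𝒫(p)`. -/
theorem lemma_gap {F : Type*} [Field F] (P : Polynomial F) (k l : ℕ) (hkl : k < l)
    (hcoeff : ∀ i : ℕ, k < i → i < l → P.coeff i = 0) :
    (Polynomial.X ^ l : Polynomial F) ∣ P ∨ P.natDegree ≤ k ∨
      ∃ q ∈ PPset (ringChar F), (l : ℤ) - (k : ℤ) ≤ Nq P q := by
  classical
  obtain ⟨A, B, rfl, hA, hB⟩ := exists_gap_decomposition P k l hcoeff
  by_cases hA0 : A = 0
  · left
    rwa [hA0, zero_add]
  by_cases hB0 : B = 0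
  · right; left
    rwa [hB0, add_zero]
  right; right
  let f := algebraMap F (AlgebraicClosure F)
  have hA0' : A.map f ≠ 0 := (Polynomial.map_ne_zero_iff f.injective).2 hA0
  have hB0' : B.map f ≠ 0 := (Polynomial.map_ne_zero_iff f.injective).2 hB0
  have hA' : (A.map f).natDegree ≤ k := Polynomial.natDegree_map_le.trans hA
  have hB' : Polynomial.X ^ l ∣ B.map f := by
    simpa using Polynomial.map_dvd f hB
  have hT : ∀ α ∈ ((A + B).map f).roots, α ≠ 0 →
      α ∈ ((A + B).map f).roots.toFinset.erase 0 := fun α hα h0 =>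
    Finset.mem_erase.2 ⟨h0, Multiset.mem_toFinset.2 hα⟩
  obtain ⟨p, hp⟩ : ∃ p, p = ringChar F := ⟨_, rfl⟩
  have hchar : CharP F p := hp ▸ ringChar.charP F
  have hcharE : CharP (AlgebraicClosure F) p := charP_of_injective_algebraMap f.injective p
  rw [← hp]
  rcases CharP.char_is_prime_or_zero F p with hprime | rfl
  · have : Fact p.Prime := ⟨hprime⟩
    obtain ⟨e, he⟩ := exists_gap_le_sum_rootWeight p (A.map f) (B.map f) k l hkl hA0' hB0' hA' hB'
    refine ⟨p ^ e, by rw [PPset, if_neg hprime.ne_zero]; exact ⟨e, rfl⟩, ?_⟩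
    rw [Nq_eq_sum_rootWeight (pow_pos hprime.pos e)]
    rw [← Polynomial.map_add] at he
    exact he _ (Finset.notMem_erase _ _) hT
  · have : CharZero (AlgebraicClosure F) := CharP.charP_to_charZero _
    refine ⟨1, by simp [PPset], ?_⟩
    rw [Nq_eq_sum_rootWeight one_pos]
    rw [Polynomial.map_add] at hT ⊢
    refine gap_le_sum_rootWeight_one hA' hB' (fun hW => ?_) _ hT
    exact (natDegree_lt_natDegree_of_gap hkl hB0' hA' hB').ne
      (natDegree_eq_of_derivative_mul_eq hA0' hB0' hW)
end

section
/- Let F be a field of characteristic p (with the convention p = ∞ if F has characteristic zero), and let A and B be finite subsets of F. Let k, m, n be nonnegative integers and let Q(x,y) be a polynomial over F of total degree less than k + m + n. If |A| > k and |B| > m, then |{a+b : a ∈ A, b ∈ B, and a^k b^m (a+b)^n ≠ Q(a,b)}| ≥ min{p − n, |A| + |B| − k − m − n − 1}. -/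
open MvPolynomial in
/-- Subtracting constants from the factors of a product `P * s ^ #S`, with `s` of degree at most
one, does not change the coefficients in top degree. -/
theorem MvPolynomial.coeff_mul_prod_sub_C {σ R ι : Type*} [CommRing R] (s : MvPolynomial σ R)
    (hs : s.totalDegree ≤ 1) (c : ι → R) (S : Finset ι) (t : σ →₀ ℕ) (P : MvPolynomial σ R)
    (hP : P.totalDegree + S.card ≤ t.degree) :
    coeff t (P * ∏ i ∈ S, (s - C (c i))) = coeff t (P * s ^ S.card) := by
  classical
  induction S using Finset.induction_on generalizing P with
  | empty => simp
  | insert i S hi ih =>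
    rw [Finset.card_insert_of_notMem hi] at hP ⊢
    have hlow : coeff t (C (c i) * P * ∏ j ∈ S, (s - C (c j))) = 0 := by
      refine coeff_eq_zero_of_totalDegree_lt (lt_of_lt_of_le ?_ hP)
      have h₁ : (∏ j ∈ S, (s - C (c j))).totalDegree ≤ S.card := by
        refine (totalDegree_finsetProd _ _).trans ?_
        simpa using Finset.sum_le_card_nsmul S _ 1
          fun j _ => (totalDegree_sub_C_le s (c j)).trans hs
      have h₂ := totalDegree_mul (C (c i) * P) (∏ j ∈ S, (s - C (c j)))
      have h₃ := totalDegree_mul (C (c i)) P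
      rw [totalDegree_C] at h₃
      omega
    have hsplit : P * ∏ j ∈ insert i S, (s - C (c j)) =
        P * s * ∏ j ∈ S, (s - C (c j)) - C (c i) * P * ∏ j ∈ S, (s - C (c j)) := by
      rw [Finset.prod_insert hi]
      ring
    have hPs := totalDegree_mul P s
    rw [hsplit, coeff_sub, hlow, sub_zero, ih (P * s) (by omega), pow_succ']
    ring_nf

theorem natCast_choose_ne_zero_of_lt_ringChar {F : Type*} [Field F] {N i : ℕ} (hi : i ≤ N)
    (hN : ringChar F = 0 ∨ N < ringChar F) : (N.choose i : F) ≠ 0 := by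
  rw [Ne, ringChar.spec]
  intro h
  rcases hN with h0 | hN
  · rw [h0, zero_dvd_iff] at h
    exact (Nat.choose_pos hi).ne' h
  · have hp : (ringChar F).Prime :=
      (CharP.char_is_prime_or_zero F (ringChar F)).resolve_right (by omega)
    have hdvd : ringChar F ∣ N.factorial := by
      rw [← Nat.choose_mul_factorial_mul_factorial hi, mul_assoc]
      exact h.mul_right _
    exact absurd (hp.dvd_factorial.mp hdvd) (by omega)

open MvPolynomial in
/-- If every `a + b` with `a ^ k * b ^ m * (a + b) ^ n ≠ Q(a, b)` lies in `S`, and binomial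
coefficients `(n + #S).choose i` do not vanish in `F`, then `S` is large. -/
theorem card_add_card_le_of_forall_add_mem {F : Type*} [Field F] (A B S : Finset F)
    (k m n : ℕ) (Q : MvPolynomial (Fin 2) F) (hQ : Q.totalDegree < k + m + n)
    (hA : k < A.card) (hB : m < B.card)
    (hS : ∀ a ∈ A, ∀ b ∈ B, a ^ k * b ^ m * (a + b) ^ n ≠ eval ![a, b] Q → a + b ∈ S)
    (hchar : ringChar F = 0 ∨ n + S.card < ringChar F) :
    A.card + B.card ≤ k + m + n + S.card + 1 := by
  by_contra! hlt
  obtain ⟨i, j, hij, hi, hj⟩ : ∃ i j, i + j = n + S.card ∧ k + i < A.card ∧ m + j < B.card :=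
    ⟨min (n + S.card) (A.card - 1 - k), n + S.card - min (n + S.card) (A.card - 1 - k),
      by omega, by omega, by omega⟩
  set s : MvPolynomial (Fin 2) F := X 0 + X 1 with hs
  have hs1 : s.totalDegree ≤ 1 := (totalDegree_add _ _).trans (by simp)
  set e : Fin 2 →₀ ℕ := Finsupp.single 0 k + Finsupp.single 1 m with he
  set u : Fin 2 →₀ ℕ := Finsupp.single 0 i + Finsupp.single 1 j with hu
  have hdeg : (e + u).degree = k + m + n + S.card := by
    simp [Finsupp.degree_eq_sum, he, hu]
    omega
  set P : MvPolynomial (Fin 2) F := monomial e 1 * s ^ n - Q with hP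
  set f : MvPolynomial (Fin 2) F := P * ∏ c ∈ S, (s - C c) with hf
  have hM : (monomial e (1 : F) * s ^ n).totalDegree ≤ k + m + n := by
    have h₁ := totalDegree_mul (monomial e (1 : F)) (s ^ n)
    have h₂ := (totalDegree_pow s n).trans (Nat.mul_le_mul_left n hs1)
    have h₃ : (monomial e (1 : F)).totalDegree = k + m := by
      rw [totalDegree_monomial _ one_ne_zero]
      exact (Finsupp.degree_eq_sum e).trans (by simp [he])
    omega
  have hPdeg : P.totalDegree ≤ k + m + n :=
    (totalDegree_sub _ _).trans (max_le hM hQ.le)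
  have hQcoeff : coeff (e + u) (Q * s ^ S.card) = 0 := by
    refine coeff_eq_zero_of_totalDegree_lt (lt_of_lt_of_le ?_ hdeg.ge)
    have h₁ := totalDegree_mul Q (s ^ S.card)
    have h₂ := (totalDegree_pow s S.card).trans (Nat.mul_le_mul_left _ hs1)
    omega
  have hcoeff : coeff (e + u) f ≠ 0 := by
    rw [hf, coeff_mul_prod_sub_C s hs1 _ S _ P (by omega), hP, sub_mul, coeff_sub, hQcoeff,
      sub_zero, mul_assoc, ← pow_add, coeff_monomial_mul, one_mul, hs, coeff_add_pow, if_pos]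
    · exact natCast_choose_ne_zero_of_lt_ringChar (by simp [hu]; omega) hchar
    · simp [hu, hij]
  have hfdeg : f.totalDegree = (e + u).degree := by
    refine le_antisymm ?_ (le_totalDegree (mem_support_iff.mpr hcoeff))
    have h₁ : (∏ c ∈ S, (s - C c)).totalDegree ≤ S.card := by
      refine (totalDegree_finsetProd _ _).trans ?_
      simpa using Finset.sum_le_card_nsmul S _ 1
        fun c _ => (totalDegree_sub_C_le s c).trans hs1
    have h₂ := totalDegree_mul P (∏ c ∈ S, (s - C c))
    rw [← hf] at h₂
    omega
  obtain ⟨x, hx, hne⟩ := combinatorial_nullstellensatz_exists_eval_nonzero f (e + u) hcoeff hfdeg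
    ![A, B] (by simp [Fin.forall_fin_two, he, hu, hi, hj])
  have hxv : x = ![x 0, x 1] := by
    ext l
    fin_cases l <;> rfl
  have hPe : eval x P ≠ 0 := fun h => hne (by rw [hf, eval_mul, h, zero_mul])
  refine hne ?_
  rw [hf, eval_mul, eval_prod]
  have hmem : x 0 + x 1 ∈ S := by
    refine hS _ (hx 0) _ (hx 1) fun h => hPe ?_
    rw [← hxv] at h
    simp [hP, hs, he, eval_monomial, Finsupp.prod_fintype, h]
  rw [Finset.prod_eq_zero hmem (by simp [hs]), mul_zero]

/-- Corollary 1: Let `F` be a field of characteristic `p` (with `p = ∞`,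
i.e. `⊤ : ℕ∞`, when `char F = 0`), `A, B` finite subsets of `F`, `k, m, n` nonnegative
integers and `Q(x,y)` a polynomial over `F` of total degree `< k + m + n`.  If `|A| > k`
and `|B| > m`, then
`|{a+b : a ∈ A, b ∈ B, a^k b^m (a+b)^n ≠ Q(a,b)}| ≥ min{p − n, |A|+|B|−k−m−n−1}`. -/
theorem card_restricted_sumset_monomial_ne {F : Type*} [Field F] (A B : Finset F)
    (k m n : ℕ) (Q : MvPolynomial (Fin 2) F) (hQ : Q.totalDegree < k + m + n)
    (hA : k < A.card) (hB : m < B.card) :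
    min ((if ringChar F = 0 then (⊤ : ℕ∞) else (ringChar F : ℕ∞)) - (n : ℕ∞))
        ((A.card : ℕ∞) + (B.card : ℕ∞) - (k : ℕ∞) - (m : ℕ∞) - (n : ℕ∞) - 1)
      ≤ ({c : F | ∃ a ∈ A, ∃ b ∈ B,
            a ^ k * b ^ m * (a + b) ^ n ≠ MvPolynomial.eval ![a, b] Q ∧ a + b = c}.ncard
          : ℕ∞) := by
  classical
  set T : Set F := {c : F | ∃ a ∈ A, ∃ b ∈ B,
    a ^ k * b ^ m * (a + b) ^ n ≠ MvPolynomial.eval ![a, b] Q ∧ a + b = c} with hT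
  have hfin : T.Finite := by
    refine ((A ×ˢ B).image fun x => x.1 + x.2).finite_toSet.subset ?_
    rintro c ⟨a, ha, b, hb, -, rfl⟩
    exact Finset.mem_image_of_mem (fun x : F × F => x.1 + x.2) (Finset.mk_mem_product ha hb)
  have key := card_add_card_le_of_forall_add_mem A B hfin.toFinset k m n Q hQ hA hB
    fun a ha b hb h => hfin.mem_toFinset.mpr ⟨a, ha, b, hb, h, rfl⟩
  rw [← Set.ncard_eq_toFinset_card T hfin] at key
  by_cases hchar : ringChar F = 0 ∨ n + T.ncard < ringChar F
  · have h := key hchar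
    refine min_le_of_right_le ?_
    norm_cast
    omega
  · push Not at hchar
    obtain ⟨h0, h⟩ := hchar
    refine min_le_of_left_le ?_
    rw [if_neg h0]
    norm_cast
    omega
end

section
/- Let F be a field of characteristic p ≠ 2 (with the convention p = ∞ if F has characteristic zero), and let A, B, and S be finite nonempty subsets of F. Let q be the largest element of 𝒫(p) not exceeding |S|. Then |{a+b : a ∈ A, b ∈ B, and a − b ∉ S}| ≥ min{p, |A| + |B| − |S| − q − 1}. -/
section

open Polynomial

/-- The coefficients of `(1 - X) ^ u` are nonzero in degrees at most `u`, if `u` is smaller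
than the characteristic. -/
theorem coeff_one_sub_X_pow_ne_zero {F : Type*} [Field F] {p : ℕ} [CharP F p] (hp : p.Prime)
    {u t : ℕ} (hu : u < p) (ht : t ≤ u) : ((1 - X : F[X]) ^ u).coeff t ≠ 0 := by
  have h : (1 - X : F[X]) ^ u = C ((-1) ^ u) * (X + C (-1)) ^ u := by
    rw [C_pow, ← mul_pow]; simp [sub_eq_add_neg]
  rw [h, coeff_C_mul, coeff_X_add_C_pow]
  refine mul_ne_zero (by simp) (mul_ne_zero (by simp) ?_)
  rw [Ne, CharP.cast_eq_zero_iff F p]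
  intro hd
  have := (Nat.choose_mul_factorial_mul_factorial ht) ▸
    (hd.mul_right t.factorial).mul_right (u - t).factorial
  exact absurd ((hp.dvd_factorial).1 this) (by omega)

theorem coeff_expand_mul_of_natDegree_lt {R : Type*} [CommRing R] {q : ℕ} (a : R[X]) {g : R[X]}
    (hg : g.natDegree < q) {t s : ℕ} (hs : s < q) :
    (expand R q a * g).coeff (t * q + s) = a.coeff t * g.coeff s := by
  induction a using Polynomial.induction_on' with
  | add a b ha hb => simp [add_mul, ha, hb]
  | monomial n c =>
    rw [expand_monomial, ← C_mul_X_pow_eq_monomial, mul_assoc, coeff_C_mul, coeff_X_pow_mul',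
      coeff_monomial]
    rcases lt_trichotomy n t with h | rfl | h
    · have : n * q + q ≤ t * q := by nlinarith
      rw [if_pos (by omega), if_neg h.ne, coeff_eq_zero_of_natDegree_lt (by omega)]; simp
    · simp [mul_comm]
    · have : t * q + q ≤ n * q := by nlinarith
      rw [if_neg (by omega), if_neg h.ne']; simp

/-- If a multiple `f * E` has a nonzero coefficient in degree `M`, then `f` has a nonzero
coefficient in some degree between `M - natDegree E` and `M`. -/
theorem exists_coeff_ne_zero_of_coeff_mul_ne_zero {R : Type*} [CommRing R] {f E : R[X]} {M e : ℕ}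
    (hE : E.natDegree ≤ e) (h : (f * E).coeff M ≠ 0) :
    ∃ i, M ≤ i + e ∧ i ≤ M ∧ f.coeff i ≠ 0 := by
  rw [coeff_mul] at h
  obtain ⟨⟨i, k⟩, hik, hne⟩ := Finset.exists_ne_zero_of_sum_ne_zero h
  rw [Finset.HasAntidiagonal.mem_antidiagonal] at hik
  dsimp only at hik hne
  refine ⟨i, ?_, by omega, left_ne_zero_of_mul hne⟩
  have := le_natDegree_of_ne_zero (right_ne_zero_of_mul hne)
  omega

theorem natDegree_one_sub_X_pow_mul_le {R : Type*} [CommRing R] (a b : ℕ) :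
    ((1 - X : R[X]) ^ a * (1 + X) ^ b).natDegree ≤ a + b := by
  compute_degree

theorem coeff_geom_sum_X {R : Type*} [CommRing R] (N M : ℕ) :
    (∑ i ∈ Finset.range N, (X : R[X]) ^ i).coeff M = if M < N then 1 else 0 := by
  simp [coeff_X_pow]

theorem coeff_geom_sum_neg_X {R : Type*} [CommRing R] (N M : ℕ) :
    (∑ i ∈ Finset.range N, (-X : R[X]) ^ i).coeff M = if M < N then (-1) ^ M else 0 := by
  have h (i : ℕ) : (-X : R[X]) ^ i = C ((-1) ^ i) * X ^ i := by
    rw [C_pow, ← mul_pow]; simp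
  simp only [finsetSum_coeff, h, coeff_C_mul, coeff_X_pow]
  simp

/-- Among `p ^ k + 1` consecutive coefficients of `(1 - X) ^ m * (1 + X) ^ n`, one is nonzero. -/
theorem exists_coeff_ne_zero_of_prime_pow {F : Type*} [Field F] {p : ℕ} [CharP F p]
    (hp : p.Prime) (hp2 : p ≠ 2) {k q m n j : ℕ} (hk : k ≠ 0) (hq : q = p ^ k)
    (hm : m < p * q) (hn : n < p) (hj : j + q ≤ m + n) :
    ∃ i, j ≤ i ∧ i ≤ j + q ∧ ((1 - X : F[X]) ^ m * (1 + X) ^ n).coeff i ≠ 0 := by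
  have : Fact p.Prime := ⟨hp⟩
  have hpq : p ≤ q := hq ▸ Nat.le_self_pow hk p
  have hp0 := hp.pos
  have hq0 : 0 < q := by omega
  have h2 : (2 : F) ≠ 0 := by
    have h : ((2 : ℕ) : F) ≠ 0 := by
      rw [Ne, CharP.cast_eq_zero_iff F p, Nat.prime_dvd_prime_iff_eq hp Nat.prime_two]
      exact hp2
    simpa using h
  have hsub : (1 - X : F[X]) ^ q = 1 - X ^ q := by rw [hq, sub_pow_char_pow, one_pow]
  have hadd : (1 + X : F[X]) ^ p = 1 + X ^ p := by rw [add_pow_char, one_pow]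
  obtain ⟨u, v, hv, rfl⟩ : ∃ u v, v < q ∧ m = u * q + v :=
    ⟨m / q, m % q, Nat.mod_lt _ hq0, (Nat.div_add_mod' m q).symm⟩
  have hu : u < p := by
    by_contra h
    have : p * q ≤ u * q := Nat.mul_le_mul_right q (not_lt.1 h)
    omega
  have hexp (w : ℕ) : (1 - X : F[X]) ^ (w * q) = expand F q ((1 - X) ^ w) := by
    rw [mul_comm, pow_mul, hsub]; simp
  rcases lt_or_ge (v + n) q with hvn | hvn
  · -- the coefficient at a multiple of `q` does not vanish
    obtain ⟨t, ht1, ht2⟩ : ∃ t, j ≤ t * q ∧ t * q < j + q := by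
      refine ⟨(j + (q - 1)) / q, ?_, ?_⟩
      · have h1 := Nat.div_add_mod' (j + (q - 1)) q
        have h2 := Nat.mod_lt (j + (q - 1)) hq0
        omega
      · have h1 := Nat.div_mul_le_self (j + (q - 1)) q
        omega
    refine ⟨t * q, ht1, by omega, ?_⟩
    have htu : t ≤ u := by
      by_contra h
      have : (u + 1) * q ≤ t * q := Nat.mul_le_mul_right q (by omega)
      rw [add_mul] at this
      omega
    have hc := coeff_expand_mul_of_natDegree_lt ((1 - X : F[X]) ^ u)
      ((natDegree_one_sub_X_pow_mul_le (R := F) v n).trans_lt hvn) (t := t) hq0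
    rw [add_zero, ← hexp, ← mul_assoc, ← pow_add] at hc
    rw [hc]
    refine mul_ne_zero (coeff_one_sub_X_pow_ne_zero hp hu htu) ?_
    simp [coeff_zero_eq_eval_zero]
  obtain ⟨α, hα⟩ : ∃ α, v + (α + 1) = q := ⟨q - v - 1, by omega⟩
  obtain ⟨β, hβ⟩ : ∃ β, n + (β + 1) = p := ⟨p - n - 1, by omega⟩
  set f : F[X] := (1 - X) ^ (u * q + v) * (1 + X) ^ n with hf
  have key : f * ((1 - X) ^ (α + 1) * (1 + X) ^ (β + 1)) =
      (1 - X) ^ ((u + 1) * q) * (1 + X ^ p) := by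
    calc f * ((1 - X) ^ (α + 1) * (1 + X) ^ (β + 1))
        = (1 - X) ^ (u * q + (v + (α + 1))) * (1 + X) ^ (n + (β + 1)) := by rw [hf]; ring
      _ = _ := by rw [hα, hβ, hadd]; ring
  have hX1 : (1 - X : F[X]) ≠ 0 := by
    intro h; simpa using congrArg (coeff · 0) h
  have hX2 : (1 + X : F[X]) ≠ 0 := by
    intro h; simpa using congrArg (coeff · 0) h
  suffices h : (f * ((1 - X) ^ α * (1 + X) ^ (β + 1))).coeff (j + q) ≠ 0 ∨
      (f * ((1 - X) ^ (α + 1) * (1 + X) ^ β)).coeff (j + q) ≠ 0 by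
    rcases h with h | h
    all_goals
      obtain ⟨i, h1, h2, h3⟩ :=
        exists_coeff_ne_zero_of_coeff_mul_ne_zero (natDegree_one_sub_X_pow_mul_le _ _) h
      exact ⟨i, by omega, h2, h3⟩
  rcases eq_or_ne (u + 1) p with hup | hup
  · left
    have e : f * ((1 - X) ^ α * (1 + X) ^ (β + 1)) =
        (∑ i ∈ Finset.range (p * q), X ^ i) * (1 + X ^ p) := by
      apply mul_left_cancel₀ hX1
      have h1 : (1 - X : F[X]) ^ (p * q) = 1 - X ^ (p * q) := by
        rw [hq, ← pow_succ', sub_pow_char_pow, one_pow]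
      rw [← mul_assoc (1 - X) (Finset.sum _ _), mul_neg_geom_sum, ← h1]
      rw [hup] at key
      rw [← key]
      ring
    have hM : j + q < p * q + p := by
      rw [← hup, add_mul]; omega
    rw [e, mul_add, mul_one, coeff_add, coeff_mul_X_pow', coeff_geom_sum_X, coeff_geom_sum_X]
    split_ifs <;> first | omega | simp [h2, one_add_one_eq_two]
  obtain ⟨t, s, hs, hM⟩ : ∃ t s, s < q ∧ j + q = t * q + s :=
    ⟨(j + q) / q, (j + q) % q, Nat.mod_lt _ hq0, (Nat.div_add_mod' _ q).symm⟩
  have hle : ∀ w, w < t → w * q + q ≤ t * q := fun w hw => by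
    have := Nat.mul_le_mul_right q (Nat.succ_le_of_lt hw)
    rwa [Nat.succ_mul] at this
  rcases lt_or_ge s p with hsp | hsp
  · right
    have e : f * ((1 - X) ^ (α + 1) * (1 + X) ^ β) =
        expand F q ((1 - X) ^ (u + 1)) * ∑ i ∈ Finset.range p, (-X) ^ i := by
      apply mul_left_cancel₀ hX2
      have h1 : (1 + X : F[X]) * ∑ i ∈ Finset.range p, (-X) ^ i = 1 + X ^ p := by
        have := mul_neg_geom_sum (-X : F[X]) p
        rwa [sub_neg_eq_add, (hp.odd_of_ne_two hp2).neg_pow, sub_neg_eq_add] at this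
      rw [mul_left_comm (1 + X) (expand F q _), h1, ← hexp, ← key]
      ring
    have hd : (∑ i ∈ Finset.range p, (-X : F[X]) ^ i).natDegree < q := by
      refine lt_of_lt_of_le ?_ hpq
      rw [Nat.lt_iff_le_pred hp0, natDegree_le_iff_coeff_eq_zero]
      intro N hN
      rw [coeff_geom_sum_neg_X, if_neg (by omega)]
    rw [hM, e, coeff_expand_mul_of_natDegree_lt _ hd hs, coeff_geom_sum_neg_X, if_pos hsp]
    refine mul_ne_zero (coeff_one_sub_X_pow_ne_zero hp (by omega) ?_) (by simp)
    by_contra h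
    have := hle (u + 1) (by omega)
    rw [add_mul] at this
    omega
  · left
    have e : f * ((1 - X) ^ α * (1 + X) ^ (β + 1)) =
        expand F q ((1 - X) ^ u) * (∑ i ∈ Finset.range q, X ^ i) * (1 + X ^ p) := by
      apply mul_left_cancel₀ hX1
      rw [mul_assoc (expand F q _), mul_left_comm (1 - X) (expand F q _),
        ← mul_assoc (1 - X) (Finset.sum _ _), mul_neg_geom_sum, ← hexp, ← hsub,
        ← mul_assoc ((1 - X) ^ (u * q)), ← pow_add, ← Nat.succ_mul, Nat.succ_eq_add_one, ← key]
      ring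
    have hd : (∑ i ∈ Finset.range q, (X : F[X]) ^ i).natDegree < q := by
      rw [Nat.lt_iff_le_pred hq0, natDegree_le_iff_coeff_eq_zero]
      intro N hN
      rw [coeff_geom_sum_X, if_neg (by omega)]
    rw [hM, e, mul_add, mul_one, coeff_add, coeff_mul_X_pow', if_pos (by omega),
      Nat.add_sub_assoc hsp, coeff_expand_mul_of_natDegree_lt _ hd hs,
      coeff_expand_mul_of_natDegree_lt _ hd (by omega), coeff_geom_sum_X, coeff_geom_sum_X,
      if_pos hs, if_pos (by omega), ← two_mul, mul_one]
    refine mul_ne_zero h2 (coeff_one_sub_X_pow_ne_zero hp hu ?_)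
    by_contra h
    have := hle u (by omega)
    omega

/-- If `G` satisfies the first-order differential equation of `(1 - X) ^ m * (1 + X) ^ n`, whose
local form at a point `c` forces the vanishing order of `G` there to be congruent to `m`, then
`(X - C c) ^ m` divides `G`. -/
theorem X_sub_C_pow_dvd_of_mul_derivative_eq {F : Type*} [Field F] {m : ℕ}
    (hm : ∀ a : ℕ, 0 < a → a ≤ m → (a : F) ≠ 0) {c : F} {G K L : F[X]}
    (hK : K.eval c ≠ 0) (hL : L.eval c = m * K.eval c)
    (h : (X - C c) * K * derivative G = L * G) : (X - C c) ^ m ∣ G := by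
  suffices ∀ a ≤ m, (X - C c) ^ a ∣ G from this m le_rfl
  intro a
  induction a with
  | zero => simp
  | succ a ih =>
    intro ha
    obtain ⟨G₂, rfl⟩ := ih (by omega)
    have hX : (X - C c) ^ a ≠ 0 := pow_ne_zero _ (X_sub_C_ne_zero c)
    have h' : (X - C c) * K * derivative G₂ + C (a : F) * K * G₂ = L * G₂ := by
      apply mul_left_cancel₀ hX
      rw [derivative_mul, derivative_X_sub_C_pow] at h
      rcases a with _ | a
      · simpa using h
      · rw [add_tsub_cancel_right] at h
        linear_combination h
    have he := congrArg (eval c) h'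
    simp only [eval_add, eval_mul, eval_sub, eval_X, eval_C, sub_self, zero_mul, zero_add, hL] at he
    have hma := hm (m - a) (by omega) (by omega)
    rw [Nat.cast_sub (by omega)] at hma
    have h0 : ((m : F) - a) * (eval c K * eval c G₂) = 0 := by linear_combination -he
    have hG₂ : eval c G₂ = 0 := by simpa [hma, hK] using h0
    rw [pow_succ]
    exact mul_dvd_mul_left _ (dvd_iff_isRoot.2 hG₂)

/-- Two consecutive coefficients of `(1 - X) ^ m * (1 + X) ^ n` do not both vanish if `m` and `n`
are smaller than the characteristic. -/
theorem coeff_ne_zero_or_coeff_succ_ne_zero {F : Type*} [Field F] (h2 : (2 : F) ≠ 0) {m n : ℕ}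
    (hm : ∀ a : ℕ, 0 < a → a ≤ m → (a : F) ≠ 0) (hn : ∀ a : ℕ, 0 < a → a ≤ n → (a : F) ≠ 0)
    {i : ℕ} (hi : i < m + n) :
    ((1 - X : F[X]) ^ m * (1 + X) ^ n).coeff i ≠ 0 ∨
      ((1 - X : F[X]) ^ m * (1 + X) ^ n).coeff (i + 1) ≠ 0 := by
  by_contra! hzero
  obtain ⟨hz1, hz2⟩ := hzero
  set f : F[X] := (1 - X) ^ m * (1 + X) ^ n with hf
  set L : F[X] := C ((n : F) - m) - C ((n : F) + m) * X with hL
  have hf0 : f.coeff 0 = 1 := by simp [hf, coeff_zero_eq_eval_zero]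
  have hfL : (1 - X ^ 2) * derivative f = L * f := by
    have hd1 : (1 - X) * derivative ((1 - X : F[X]) ^ m) = -C (m : F) * (1 - X) ^ m := by
      rw [derivative_pow]
      rcases m with _ | m
      · simp
      · simp [pow_succ]; ring
    have hd2 : (1 + X) * derivative ((1 + X : F[X]) ^ n) = C (n : F) * (1 + X) ^ n := by
      rw [derivative_pow]
      rcases n with _ | n
      · simp
      · simp [pow_succ]; ring
    rw [hf, derivative_mul, hL, C_sub, C_add]
    linear_combination (1 + X) * (1 + X) ^ n * hd1 + (1 - X) * (1 - X) ^ m * hd2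
  obtain ⟨G, hG⟩ : ∃ G : F[X], ∀ k, G.coeff k = if k < i then f.coeff k else 0 :=
    ⟨∑ k ∈ Finset.range i, C (f.coeff k) * X ^ k, fun k => by
      simp [coeff_X_pow]⟩
  have hGf : ∀ k < i + 2, G.coeff k = f.coeff k := fun k hk => by
    rw [hG]
    split_ifs with h
    · rfl
    · obtain rfl | rfl : k = i ∨ k = i + 1 := by omega
      exacts [hz1.symm, hz2.symm]
  have hG0 : ∀ k, i ≤ k → G.coeff k = 0 := fun k hk => by rw [hG, if_neg (by omega)]
  have hc0 (P : F[X]) : ((1 - X ^ 2) * derivative P - L * P).coeff 0 =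
      P.coeff 1 - ((n : F) - m) * P.coeff 0 := by
    simp [hL, coeff_derivative]
  have hc1 (P : F[X]) (k : ℕ) : ((1 - X ^ 2) * derivative P - L * P).coeff (k + 1) =
      (k + 2) * P.coeff (k + 2) - k * P.coeff k - ((n : F) - m) * P.coeff (k + 1)
        + (n + m) * P.coeff k := by
    have : (X ^ 2 * derivative P).coeff (k + 1) = k * P.coeff k := by
      rcases k with _ | k
      · simp [coeff_X_pow_mul']
      · rw [coeff_X_pow_mul, coeff_derivative]; push_cast; ring
    rw [hL, sub_mul, sub_mul, one_mul, coeff_sub, coeff_sub, coeff_sub, this, coeff_derivative,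
      mul_assoc, coeff_C_mul, coeff_C_mul, coeff_X_mul]
    push_cast
    ring
  have hi0 : 0 < i := by
    rcases Nat.eq_zero_or_pos i with rfl | h
    · rw [hf0] at hz1; exact absurd hz1 one_ne_zero
    · exact h
  have hGL : (1 - X ^ 2) * derivative G = L * G := by
    rw [← sub_eq_zero] at hfL ⊢
    ext k
    rw [coeff_zero]
    rcases k with _ | k
    · rw [hc0, hGf 1 (by omega), hGf 0 (by omega), ← hc0, hfL, coeff_zero]
    · rcases lt_or_ge k i with hk | hk
      · rw [hc1, hGf (k + 2) (by omega), hGf (k + 1) (by omega), hGf k (by omega), ← hc1, hfL,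
          coeff_zero]
      · rw [hc1, hG0 (k + 2) (by omega), hG0 (k + 1) (by omega), hG0 k hk]
        ring
  have hG1 : (X - C 1) ^ m ∣ G := by
    refine X_sub_C_pow_dvd_of_mul_derivative_eq hm (K := -(1 + X)) (L := L) ?_ ?_ ?_
    · simpa only [eval_neg, eval_add, eval_one, eval_X, one_add_one_eq_two, neg_ne_zero] using h2
    · simp [hL]; ring
    · rw [← hGL, C_1]; ring
  have hG2 : (X - C (-1)) ^ n ∣ G := by
    refine X_sub_C_pow_dvd_of_mul_derivative_eq hn (K := 1 - X) (L := L) ?_ ?_ ?_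
    · simpa [one_add_one_eq_two] using h2
    · simp [hL]; ring
    · rw [← hGL, C_neg, C_1]; ring
  have hcop : IsCoprime (X - C (1 : F)) (X - C (-1)) := by
    apply isCoprime_X_sub_C_of_isUnit_sub
    rw [isUnit_iff_ne_zero, sub_neg_eq_add, one_add_one_eq_two]
    exact h2
  have hdvd := (hcop.pow (m := m) (n := n)).mul_dvd hG1 hG2
  have hGne : G ≠ 0 := fun h => by
    have := hGf 0 (by omega)
    rw [h, hf0, coeff_zero] at this
    exact zero_ne_one this
  have hdeg := natDegree_le_of_dvd hdvd hGne
  rw [((monic_X_sub_C (1 : F)).pow m).natDegree_mul ((monic_X_sub_C (-1 : F)).pow n),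
    natDegree_pow, natDegree_pow, natDegree_X_sub_C, natDegree_X_sub_C] at hdeg
  have : G.natDegree ≤ i := natDegree_le_iff_coeff_eq_zero.2 fun k hk => hG0 k hk.le
  omega

/-- Dehomogenization of a binary form preserves coefficients. -/
theorem coeff_aeval_X_one_of_isHomogeneous {R : Type*} [CommRing R] {d : ℕ}
    {G : MvPolynomial (Fin 2) R} (hG : G.IsHomogeneous d) (t : Fin 2 →₀ ℕ) (ht : t.degree = d) :
    (MvPolynomial.aeval ![(X : R[X]), 1] G).coeff (t 0) = G.coeff t := by
  classical
  have hdeg (s : Fin 2 →₀ ℕ) : s.degree = s 0 + s 1 := by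
    simp [Finsupp.degree_eq_sum]
  rw [MvPolynomial.aeval_def, MvPolynomial.eval₂_eq', finsetSum_coeff,
    Finset.sum_eq_single t]
  · simp
  · intro s hs hst
    have hsd : s.degree = d := by
      rw [Finsupp.degree_eq_weight_one]
      exact hG (MvPolynomial.mem_support_iff.1 hs)
    have : t 0 ≠ s 0 := fun h => hst <| by
      rw [hdeg] at hsd ht
      ext i
      fin_cases i
      · exact h.symm
      · change s 1 = t 1
        omega
    simp [coeff_X_pow, this]
  · intro h
    rw [MvPolynomial.notMem_support_iff.1 h]
    simp

theorem coeff_prod_add_C_sub_prod {R ι σ : Type*} [CommRing R] (s : Finset ι)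
    {L : ι → MvPolynomial σ R} (hL : ∀ i, (L i).IsHomogeneous 1) (c : ι → R) :
    (∏ i ∈ s, (L i + MvPolynomial.C (c i))).totalDegree ≤ s.card ∧
      ∀ t : σ →₀ ℕ, s.card ≤ t.degree →
        (∏ i ∈ s, (L i + MvPolynomial.C (c i)) - ∏ i ∈ s, L i).coeff t = 0 := by
  classical
  induction s using Finset.induction_on with
  | empty => simp
  | insert a s ha ih =>
    obtain ⟨ih1, ih2⟩ := ih
    rw [Finset.card_insert_of_notMem ha, Finset.prod_insert ha, Finset.prod_insert ha]
    set P := ∏ i ∈ s, (L i + MvPolynomial.C (c i))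
    constructor
    · refine (MvPolynomial.totalDegree_mul _ _).trans ?_
      have h : (L a + MvPolynomial.C (c a)).totalDegree ≤ 1 :=
        (MvPolynomial.totalDegree_add _ _).trans (max_le (hL a).totalDegree_le (by simp))
      omega
    · intro t ht
      have e : (L a + MvPolynomial.C (c a)) * P - L a * ∏ i ∈ s, L i =
          L a * (P - ∏ i ∈ s, L i) + MvPolynomial.C (c a) * P := by ring
      have hP : P.coeff t = 0 := by
        by_contra h
        have := MvPolynomial.le_totalDegree (MvPolynomial.mem_support_iff.2 h)
        change t.degree ≤ _ at this
        omega
      rw [e, MvPolynomial.coeff_add, MvPolynomial.coeff_C_mul, hP, mul_zero, add_zero,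
        MvPolynomial.coeff_mul]
      refine Finset.sum_eq_zero fun x hx => ?_
      rw [Finset.HasAntidiagonal.mem_antidiagonal] at hx
      by_cases h1 : x.1.degree = 1
      · rw [ih2 x.2, mul_zero]
        rw [← hx, map_add, h1] at ht
        omega
      · rw [(hL a).coeff_eq_zero h1, zero_mul]

/-- The polynomial method for restricted sums `a + b` with `a - b ∉ S`. -/
theorem lt_ncard_of_coeff_ne_zero {F : Type*} [Field F] {A B S : Finset F} {k l n : ℕ}
    (hk : k < A.card) (hl : l < B.card) (hkl : k + l = S.card + n)
    (hc : ((1 - X : F[X]) ^ S.card * (1 + X) ^ n).coeff k ≠ 0) :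
    n < {c : F | ∃ a ∈ A, ∃ b ∈ B, a - b ∉ S ∧ a + b = c}.ncard := by
  classical
  have hfin : {c : F | ∃ a ∈ A, ∃ b ∈ B, a - b ∉ S ∧ a + b = c}.Finite := by
    refine ((A ×ˢ B).image fun x => x.1 + x.2).finite_toSet.subset ?_
    rintro c ⟨a, ha, b, hb, -, rfl⟩
    exact Finset.mem_coe.2 (Finset.mem_image.2 ⟨(a, b), Finset.mem_product.2 ⟨ha, hb⟩, rfl⟩)
  by_contra! hlt
  rw [Set.ncard_eq_toFinset_card _ hfin] at hlt
  set T := hfin.toFinset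
  obtain ⟨g, hg⟩ : ∃ g : ℕ → F, ∀ c ∈ T, ∃ i < n, g i = c := by
    refine ⟨fun i => T.toList.getD i 0, fun c hcT => ?_⟩
    obtain ⟨i, hi, hic⟩ := List.mem_iff_getElem.1 (Finset.mem_toList.2 hcT)
    refine ⟨i, lt_of_lt_of_le (by simpa using hi) hlt, ?_⟩
    exact (List.getD_eq_getElem _ _ hi).trans hic
  let x : MvPolynomial (Fin 2) F := MvPolynomial.X 0
  let y : MvPolynomial (Fin 2) F := MvPolynomial.X 1
  have hx : x.IsHomogeneous 1 := MvPolynomial.isHomogeneous_X F 0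
  have hy : y.IsHomogeneous 1 := MvPolynomial.isHomogeneous_X F 1
  let L : F ⊕ ℕ → MvPolynomial (Fin 2) F := Sum.elim (fun _ => y - x) (fun _ => y + x)
  have hL : ∀ i, (L i).IsHomogeneous 1 := by
    rintro (_ | _)
    exacts [hy.sub hx, hy.add hx]
  let I := S.disjSum (Finset.range n)
  have hI : I.card = S.card + n := by simp [I]
  obtain ⟨h1, h2⟩ := coeff_prod_add_C_sub_prod I hL (Sum.elim id fun i => -g i)
  let t : Fin 2 →₀ ℕ := Finsupp.equivFunOnFinite.symm ![k, l]
  have ht : t.degree = I.card := by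
    rw [hI, ← hkl]
    simp [t, Finsupp.degree_eq_sum]
  have hhom : (∏ i ∈ I, L i).IsHomogeneous I.card := by
    simpa using MvPolynomial.IsHomogeneous.prod I L (fun _ => 1) fun i _ => hL i
  have hprod : ∏ i ∈ I, L i = (y - x) ^ S.card * (y + x) ^ n := by
    simp [I, L, Finset.prod_disjSum]
  have hcoeff : (∏ i ∈ I, L i).coeff t ≠ 0 := by
    rw [← coeff_aeval_X_one_of_isHomogeneous hhom t ht, hprod]
    simpa [x, y, t] using hc
  have hne := h2 t ht.ge
  rw [MvPolynomial.coeff_sub, sub_eq_zero] at hne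
  rw [← hne] at hcoeff
  have htd := h1.antisymm (ht ▸ MvPolynomial.le_totalDegree (MvPolynomial.mem_support_iff.2 hcoeff))
  obtain ⟨s, hs, hse⟩ := MvPolynomial.combinatorial_nullstellensatz_exists_eval_nonzero _ t hcoeff
    (htd.trans ht.symm) ![A, B] (by
      intro i
      fin_cases i
      exacts [hk, hl])
  refine hse ?_
  rw [map_prod]
  have hsA : s 0 ∈ A := hs 0
  have hsB : s 1 ∈ B := hs 1
  by_cases hS : s 0 - s 1 ∈ S
  · refine Finset.prod_eq_zero (i := Sum.inl (s 0 - s 1)) (by simpa [I] using hS) ?_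
    simp [L, x, y]
  · obtain ⟨i, hi, hgi⟩ := hg (s 0 + s 1)
      ((Set.Finite.mem_toFinset _).2 ⟨_, hsA, _, hsB, hS, rfl⟩)
    refine Finset.prod_eq_zero (i := Sum.inr i) (by simpa [I] using hi) ?_
    simp only [L, x, y, hgi, Sum.elim_inr, map_add, MvPolynomial.eval_X, MvPolynomial.eval_C]
    ring

/-- Suppose that among any `q + 1` consecutive coefficients of `(1 - X) ^ |S| * (1 + X) ^ n`
one is nonzero. If `|S| + n + q + 2 ≤ |A| + |B|`, then there are more than `n` restricted sums. -/
theorem lt_ncard_of_exists_coeff_ne_zero {F : Type*} [Field F] {A B S : Finset F} {q n : ℕ}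
    (hA : A.Nonempty) (hB : B.Nonempty) (hAB : S.card + n + q + 2 ≤ A.card + B.card)
    (h : ∀ j, j + q ≤ S.card + n → ∃ i, j ≤ i ∧ i ≤ j + q ∧
      ((1 - X : F[X]) ^ S.card * (1 + X) ^ n).coeff i ≠ 0) :
    n < {c : F | ∃ a ∈ A, ∃ b ∈ B, a - b ∉ S ∧ a + b = c}.ncard := by
  have hA0 := hA.card_pos
  have hB0 := hB.card_pos
  rcases lt_or_ge (S.card + n) B.card with h1 | h1
  · exact lt_ncard_of_coeff_ne_zero (k := 0) hA0 h1 (by omega)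
      (by simp [coeff_zero_eq_eval_zero])
  rcases lt_or_ge (S.card + n) A.card with h2 | h2
  · refine lt_ncard_of_coeff_ne_zero (l := 0) h2 hB0 (by omega) ?_
    have e : (1 - X : F[X]) ^ S.card * (1 + X) ^ n =
        C ((-1) ^ S.card) * ((X - C 1) ^ S.card * (X - C (-1)) ^ n) := by
      rw [C_pow, ← mul_assoc, ← mul_pow]
      simp [add_comm]
    have hm := ((monic_X_sub_C (1 : F)).pow S.card).mul ((monic_X_sub_C (-1 : F)).pow n)
    have hd : ((X - C (1 : F)) ^ S.card * (X - C (-1)) ^ n).natDegree = S.card + n := by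
      rw [((monic_X_sub_C (1 : F)).pow _).natDegree_mul ((monic_X_sub_C (-1 : F)).pow n),
        natDegree_pow, natDegree_pow, natDegree_X_sub_C, natDegree_X_sub_C, mul_one, mul_one]
    rw [e, coeff_C_mul, ← hd, hm.coeff_natDegree]
    simp
  obtain ⟨i, hi1, hi2, hi⟩ := h (S.card + n + 1 - B.card) (by omega)
  exact lt_ncard_of_coeff_ne_zero (k := i) (l := S.card + n - i) (by omega) (by omega) (by omega) hi

end

/-- Corollary 2: Let `F` be a field of characteristic `p ≠ 2` (with `p = ∞`,
i.e. `⊤ : ℕ∞`, when `char F = 0`), `A, B, S` finite nonempty subsets of `F`, and `q` the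
largest element of `𝒫(p)` not exceeding `|S|`.  Then
`|{a+b : a ∈ A, b ∈ B, a − b ∉ S}| ≥ min{p, |A| + |B| − |S| − q − 1}`. -/
theorem card_restricted_sumset_sub_not_mem {F : Type*} [Field F] (hchar : ringChar F ≠ 2)
    (A B S : Finset F) (hA : A.Nonempty) (hB : B.Nonempty) (hSne : S.Nonempty)
    (q : ℕ) (hq : q ∈ PPset (ringChar F)) (hqS : q ≤ S.card)
    (hqmax : ∀ r ∈ PPset (ringChar F), r ≤ S.card → r ≤ q) :
    min (if ringChar F = 0 then (⊤ : ℕ∞) else (ringChar F : ℕ∞))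
        ((A.card : ℕ∞) + (B.card : ℕ∞) - (S.card : ℕ∞) - (q : ℕ∞) - 1)
      ≤ ({c : F | ∃ a ∈ A, ∃ b ∈ B, a - b ∉ S ∧ a + b = c}.ncard : ℕ∞) := by
  set p := ringChar F
  have hcp : CharP F p := ringChar.charP F
  have h2 : (2 : F) ≠ 0 := Ring.two_ne_zero hchar
  by_contra! hlt
  set n := {c : F | ∃ a ∈ A, ∃ b ∈ B, a - b ∉ S ∧ a + b = c}.ncard
  obtain ⟨hnp, hnc⟩ := lt_min_iff.1 hlt
  have hAB : S.card + n + q + 2 ≤ A.card + B.card := by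
    have : n < A.card + B.card - S.card - q - 1 := by exact_mod_cast hnc
    omega
  have hnp' : p ≠ 0 → n < p := fun h => by
    rw [if_neg h] at hnp
    exact_mod_cast hnp
  refine absurd (lt_ncard_of_exists_coeff_ne_zero hA hB hAB ?_) (lt_irrefl n)
  have hsmall (hq1 : q = 1) (hcast : ∀ a : ℕ, 0 < a → a ≤ S.card ∨ a ≤ n → (a : F) ≠ 0)
      (j : ℕ) (hj : j + q ≤ S.card + n) : ∃ i, j ≤ i ∧ i ≤ j + q ∧
        ((1 - Polynomial.X : Polynomial F) ^ S.card * (1 + Polynomial.X) ^ n).coeff i ≠ 0 := by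
    subst hq1
    rcases coeff_ne_zero_or_coeff_succ_ne_zero h2 (fun a h0 ha => hcast a h0 (.inl ha))
      (fun a h0 ha => hcast a h0 (.inr ha)) (Nat.lt_of_succ_le hj) with h | h
    exacts [⟨j, le_rfl, by omega, h⟩, ⟨j + 1, by omega, le_rfl, h⟩]
  by_cases hp0 : p = 0
  · have hq1 : q = 1 := by simpa [PPset, hp0] using hq
    refine hsmall hq1 fun a ha _ => ?_
    rw [Ne, CharP.cast_eq_zero_iff F p, hp0, zero_dvd_iff]
    exact ha.ne'
  · have hprime : p.Prime := (CharP.char_is_prime_or_zero F p).resolve_right hp0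
    have hpow (k : ℕ) : p ^ k ∈ PPset p := by
      rw [PPset, if_neg hp0]
      exact ⟨k, rfl⟩
    obtain ⟨k, hk⟩ : ∃ k, q = p ^ k := by simpa [PPset, hp0] using hq
    have hlt_mul : S.card < p * q := by
      by_contra! h
      rw [hk, ← pow_succ'] at h
      have := hqmax _ (hpow _) h
      rw [hk] at this
      exact absurd this (not_le.2 (Nat.pow_lt_pow_succ hprime.one_lt))
    rcases eq_or_ne k 0 with rfl | hk0
    · rw [pow_zero] at hk
      refine hsmall hk fun a ha hle => ?_
      rw [Ne, CharP.cast_eq_zero_iff F p]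
      intro hd
      have h1 := Nat.le_of_dvd ha hd
      have h3 := hnp' hp0
      rw [hk, mul_one] at hlt_mul
      omega
    · exact fun j hj => exists_coeff_ne_zero_of_prime_pow hprime hchar hk0 hk hlt_mul (hnp' hp0) hj
end

section
/- Let F be a field of characteristic p (with the convention p = ∞ if F has characteristic zero), and let A and B be finite nonempty subsets of F. Let S be a finite nonempty subset of F^× × F, where F^× = F \ {0}. Then |{a+b : a ∈ A, b ∈ B, and a + u·b ≠ v for every pair (u,v) ∈ S}| ≥ min{p − |{v ∈ F : (1,v) ∈ S}|, |A| + |B| − 2|S| − 1}. -/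
open Polynomial in
/-- If `-1` is a root of multiplicity exactly `N` of a polynomial and `1, …, N` are nonzero in the
field, then the polynomial has more than `N` nonzero coefficients. -/
theorem Polynomial.lt_card_support_X_add_one_pow_mul {F : Type*} [Field F] (N : ℕ)
    (hN : ∀ k, 0 < k → k ≤ N → (k : F) ≠ 0) (R : F[X]) (hR : R.eval (-1) ≠ 0) :
    N < ((X + 1) ^ N * R).support.card := by
  induction N generalizing R with
  | zero =>
    have hR0 : R ≠ 0 := by rintro rfl; simp at hR
    simpa [Finset.card_pos] using hR0
  | succ N ih =>
    set f := (X + 1) ^ (N + 1) * R with hf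
    have hR0 : R ≠ 0 := by rintro rfl; simp at hR
    have hX : (X + 1 : F[X]) ≠ 0 := by simpa using X_add_C_ne_zero (1 : F)
    have hf0 : f ≠ 0 := mul_ne_zero (pow_ne_zero _ hX) hR0
    obtain ⟨e, he⟩ := support_nonempty.mpr hf0
    set R' := X * (((N + 1 : ℕ) : F[X]) * R + (X + 1) * derivative R) - C (e : F) * ((X + 1) * R)
      with hR'
    have hg : (X + 1) ^ N * R' = X * derivative f - C (e : F) * f := by
      simp only [hf, hR', derivative_mul, derivative_pow, derivative_add, derivative_X,
        derivative_one, Nat.add_sub_cancel, map_natCast]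
      ring
    have hev : R'.eval (-1) ≠ 0 := by
      have : R'.eval (-1) = -(((N + 1 : ℕ) : F) * R.eval (-1)) := by
        simp [hR']
      rw [this]
      exact neg_ne_zero.mpr (mul_ne_zero (hN _ (by omega) le_rfl) hR)
    have hlt := ih (fun k h0 hk => hN k h0 (by omega)) R' hev
    have hcoeff : ∀ i : ℕ, (X * derivative f - C (e : F) * f).coeff i = ((i : F) - e) * f.coeff i := by
      intro i
      rw [coeff_sub, coeff_C_mul]
      cases i with
      | zero => simp
      | succ i => rw [coeff_X_mul, coeff_derivative]; push_cast; ring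
    have hsub : ((X + 1) ^ N * R').support ⊆ f.support.erase e := by
      intro i hi
      rw [mem_support_iff, hg, hcoeff] at hi
      refine Finset.mem_erase.mpr ⟨?_, mem_support_iff.mpr (right_ne_zero_of_mul hi)⟩
      rintro rfl
      simp at hi
    have := Finset.card_le_card hsub
    rw [Finset.card_erase_of_mem he] at this
    omega

open Polynomial in
/-- Among any `d + 1` consecutive coefficients in the relevant range, one is nonzero. -/
theorem Polynomial.exists_coeff_X_add_one_pow_mul_ne_zero {F : Type*} [Field F] {N d s : ℕ}
    (hN : ∀ k, 0 < k → k ≤ N → (k : F) ≠ 0) (R : F[X]) (hR : R.eval (-1) ≠ 0)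
    (hd : R.natDegree ≤ d) (hs : s ≤ N) :
    ∃ i, s ≤ i ∧ i ≤ s + d ∧ ((X + 1) ^ N * R).coeff i ≠ 0 := by
  by_contra! h
  have hlt := lt_card_support_X_add_one_pow_mul N hN R hR
  have hsub : ((X + 1) ^ N * R).support ⊆ Finset.range (N + d + 1) \ Finset.Icc s (s + d) := by
    intro i hi
    have hi' := mem_support_iff.mp hi
    have hdeg : ((X + 1) ^ N * R).natDegree ≤ N + d :=
      natDegree_mul_le_of_le
        (by simpa using natDegree_pow_le_of_le N (natDegree_X_add_C (1 : F)).le) hd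
    have := le_natDegree_of_mem_supp i hi
    simp only [Finset.mem_sdiff, Finset.mem_range, Finset.mem_Icc]
    exact ⟨by omega, fun hh => hi' (h i hh.1 hh.2)⟩
  have := Finset.card_le_card hsub
  rw [Finset.card_sdiff_of_subset (by intro i; simp; omega)] at this
  simp only [Finset.card_range, Nat.card_Icc] at this
  omega

/-- The product of the bivariate affine forms `x + u * y - v` over a multiset of pairs `(u, v)`. -/
noncomputable def MvPolynomial.affineProd {F : Type*} [Field F] (M : Multiset (F × F)) :
    MvPolynomial (Fin 2) F :=
  (M.map fun w => X 0 + C w.1 * X 1 - C w.2).prod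

open MvPolynomial in
theorem MvPolynomial.totalDegree_affineProd_le {F : Type*} [Field F] (M : Multiset (F × F)) :
    (affineProd M).totalDegree ≤ M.card := by
  induction M using Multiset.induction_on with
  | empty => simp [affineProd]
  | cons w M ih =>
    have h1 : (X 0 + C w.1 * X 1 - C w.2 : MvPolynomial (Fin 2) F).totalDegree ≤ 1 := by
      refine (totalDegree_sub_C_le _ _).trans ((totalDegree_add _ _).trans (max_le ?_ ?_))
      · simp
      · exact (totalDegree_mul _ _).trans (by simp)
    have h2 := totalDegree_mul (X 0 + C w.1 * X 1 - C w.2) (affineProd M)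
    have h3 : affineProd (w ::ₘ M) = (X 0 + C w.1 * X 1 - C w.2) * affineProd M := by
      simp [affineProd]
    rw [h3, Multiset.card_cons]
    omega

open MvPolynomial in
/-- The top-degree coefficients of a product of affine forms `x + u * y - v` are the coefficients
of the univariate polynomial `∏ (X + u)`. -/
theorem MvPolynomial.coeff_affineProd {F : Type*} [Field F] (M : Multiset (F × F)) (i j : ℕ)
    (hij : i + j = M.card) :
    (affineProd M).coeff (Finsupp.single 0 i + Finsupp.single 1 j) =
      (M.map fun w : F × F => Polynomial.X + Polynomial.C w.1).prod.coeff i := by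
  induction M using Multiset.induction_on generalizing i j with
  | empty =>
    obtain ⟨rfl, rfl⟩ : i = 0 ∧ j = 0 := by simpa using hij
    simp [affineProd]
  | cons w M ih =>
    have h3 : affineProd (w ::ₘ M) =
        X 0 * affineProd M + C w.1 * (X 1 * affineProd M) - C w.2 * affineProd M := by
      simp [affineProd]; ring
    have hdeg := totalDegree_affineProd_le M
    rw [Multiset.card_cons] at hij
    have hlow : (affineProd M).coeff (Finsupp.single 0 i + Finsupp.single 1 j) = 0 := by
      by_contra h
      have := le_totalDegree (mem_support_iff.mpr h)
      change Finsupp.degree (Finsupp.single 0 i + Finsupp.single 1 j) ≤ _ at this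
      rw [map_add, Finsupp.degree_single, Finsupp.degree_single] at this
      omega
    have hX0 : (X 0 * affineProd M).coeff (Finsupp.single 0 i + Finsupp.single 1 j) =
        (Polynomial.X * (M.map fun w : F × F => Polynomial.X + Polynomial.C w.1).prod).coeff i := by
      cases i with
      | zero => simp [coeff_X_mul']
      | succ i =>
        rw [Polynomial.coeff_X_mul, ← ih i j (by omega), Finsupp.single_add, add_comm _
          (Finsupp.single 0 1), add_assoc, coeff_X_mul]
    have hX1 : (X 1 * affineProd M).coeff (Finsupp.single 0 i + Finsupp.single 1 j) =
        (M.map fun w : F × F => Polynomial.X + Polynomial.C w.1).prod.coeff i := by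
      cases j with
      | zero =>
        rw [Polynomial.coeff_eq_zero_of_natDegree_lt]
        · simp [coeff_X_mul']
        · refine lt_of_le_of_lt (b := M.card) ?_ (by omega)
          refine (Polynomial.natDegree_multiset_prod_le _).trans ?_
          simp
      | succ j =>
        rw [← ih i j (by omega), Finsupp.single_add, ← add_assoc, add_comm _
          (Finsupp.single 1 1), coeff_X_mul]
    rw [h3, coeff_sub, coeff_add, coeff_C_mul, coeff_C_mul, hlow, hX0, hX1]
    simp [add_mul]

/-- The sums `a + b` with `a ∈ A`, `b ∈ B` subject to the constraints `a + u * b ≠ v`. -/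
def restrictedSumset {F : Type*} [Field F] (A B : Finset F) (S : Finset (F × F)) : Set F :=
  {c : F | ∃ a ∈ A, ∃ b ∈ B, (∀ uv ∈ S, a + uv.1 * b ≠ uv.2) ∧ a + b = c}

theorem finite_restrictedSumset {F : Type*} [Field F] (A B : Finset F) (S : Finset (F × F)) :
    (restrictedSumset A B S).Finite := by
  classical
  refine (A.product B |>.image fun x => x.1 + x.2).finite_toSet.subset ?_
  rintro c ⟨a, ha, b, hb, -, rfl⟩
  exact Finset.mem_coe.mpr (Finset.mem_image.mpr ⟨(a, b), Finset.mem_product.mpr ⟨ha, hb⟩, rfl⟩)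

theorem card_left_le_ncard_restrictedSumset_add {F : Type*} [Field F] (A B : Finset F)
    (hB : B.Nonempty) (S : Finset (F × F)) :
    A.card ≤ (restrictedSumset A B S).ncard + S.card := by
  classical
  obtain ⟨b, hb⟩ := hB
  have h1 : A.card ≤ (A \ S.image fun w => w.2 - w.1 * b).card + S.card :=
    Finset.card_le_card_sdiff_add_card.trans
      (Nat.add_le_add_left Finset.card_image_le _)
  have h2 : (A \ S.image fun w => w.2 - w.1 * b).card ≤ (restrictedSumset A B S).ncard := by
    rw [← Finset.card_image_of_injective _ (add_left_injective b), ← Set.ncard_coe_finset]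
    refine Set.ncard_le_ncard ?_ (finite_restrictedSumset A B S)
    intro c hc
    obtain ⟨a, ha, rfl⟩ := Finset.mem_image.mp hc
    obtain ⟨ha, hna⟩ := Finset.mem_sdiff.mp ha
    refine ⟨a, ha, b, hb, fun w hw h => hna (Finset.mem_image.mpr ⟨w, hw, ?_⟩), rfl⟩
    rw [← h]; ring
  omega

theorem card_right_le_ncard_restrictedSumset_add {F : Type*} [Field F] (A B : Finset F)
    (hA : A.Nonempty) (S : Finset (F × F)) (hS0 : ∀ uv ∈ S, uv.1 ≠ 0) :
    B.card ≤ (restrictedSumset A B S).ncard + S.card := by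
  classical
  obtain ⟨a, ha⟩ := hA
  have h1 : B.card ≤ (B \ S.image fun w => (w.2 - a) / w.1).card + S.card :=
    Finset.card_le_card_sdiff_add_card.trans
      (Nat.add_le_add_left Finset.card_image_le _)
  have h2 : (B \ S.image fun w => (w.2 - a) / w.1).card ≤ (restrictedSumset A B S).ncard := by
    rw [← Finset.card_image_of_injective _ (add_right_injective a), ← Set.ncard_coe_finset]
    refine Set.ncard_le_ncard ?_ (finite_restrictedSumset A B S)
    intro c hc
    obtain ⟨b, hb, rfl⟩ := Finset.mem_image.mp hc
    obtain ⟨hb, hnb⟩ := Finset.mem_sdiff.mp hb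
    refine ⟨a, ha, b, hb, fun w hw h => hnb (Finset.mem_image.mpr ⟨w, hw, ?_⟩), rfl⟩
    rw [div_eq_iff (hS0 w hw), ← h]; ring
  omega

/-- The lower bound for a restricted sumset, provided the positive integers up to
`|restrictedSumset A B S| + |{v | (1, v) ∈ S}|` are nonzero in the field. -/
theorem card_add_card_le_of_natCast_ne_zero {F : Type*} [Field F] (A B : Finset F)
    (hA : A.Nonempty) (hB : B.Nonempty) (S : Finset (F × F)) (hS0 : ∀ uv ∈ S, uv.1 ≠ 0)
    (hN : ∀ k, 0 < k → k ≤ (restrictedSumset A B S).ncard + {v : F | (1, v) ∈ S}.ncard →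
      (k : F) ≠ 0) :
    A.card + B.card ≤ (restrictedSumset A B S).ncard + 2 * S.card + 1 := by
  classical
  have hleft := card_left_le_ncard_restrictedSumset_add A B hB S
  have hright := card_right_le_ncard_restrictedSumset_add A B hA S hS0
  by_contra! hlt
  set C := (finite_restrictedSumset A B S).toFinset with hC
  have hCcard : (restrictedSumset A B S).ncard = C.card :=
    Set.ncard_eq_toFinset_card _ (finite_restrictedSumset A B S)
  have hm : {v : F | (1, v) ∈ S}.ncard = (S.filter fun w => w.1 = 1).card := by
    rw [← Set.ncard_coe_finset, ← Set.ncard_image_of_injective _ (Prod.mk_right_injective (1 : F))]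
    congr 1
    ext ⟨u, v⟩
    simp only [Set.mem_image, Set.mem_ofPred_eq, Prod.mk.injEq, Finset.coe_filter]
    constructor
    · rintro ⟨v, hv, rfl, rfl⟩; exact ⟨hv, rfl⟩
    · rintro ⟨hv, rfl⟩; exact ⟨v, hv, rfl, rfl⟩
  have hcard := Finset.card_filter_add_card_filter_not (s := S) (fun w : F × F => w.1 = 1)
  set R : Polynomial F :=
    ∏ w ∈ S.filter (fun w => ¬ w.1 = 1), (Polynomial.X + Polynomial.C w.1) with hR
  have hReval : R.eval (-1) ≠ 0 := by
    rw [hR, Polynomial.eval_prod, Finset.prod_ne_zero_iff]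
    intro w hw h
    simp only [Polynomial.eval_add, Polynomial.eval_X, Polynomial.eval_C] at h
    exact (Finset.mem_filter.mp hw).2 (by linear_combination h)
  have hRdeg : R.natDegree ≤ S.card := by
    refine (Polynomial.natDegree_prod_le _ _).trans ?_
    simp only [Polynomial.natDegree_X_add_C, Finset.sum_const, smul_eq_mul, mul_one]
    omega
  rw [hCcard, hm] at hN
  obtain ⟨i, hi1, hi2, hi⟩ := Polynomial.exists_coeff_X_add_one_pow_mul_ne_zero
    (s := C.card + S.card - (B.card - 1)) hN R hReval hRdeg (by omega)
  set M : Multiset (F × F) := S.val + C.val.map fun c => (1, c) with hM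
  have hMcard : M.card = S.card + C.card := by simp [hM]
  have hprod : (M.map fun w : F × F => Polynomial.X + Polynomial.C w.1).prod =
      (Polynomial.X + 1) ^ (C.card + (S.filter fun w => w.1 = 1).card) * R := by
    have h1 : ∏ w ∈ S.filter (fun w => w.1 = 1), (Polynomial.X + Polynomial.C w.1) =
        (Polynomial.X + 1) ^ (S.filter fun w => w.1 = 1).card := by
      rw [← Finset.prod_const]
      refine Finset.prod_congr rfl fun w hw => ?_
      rw [(Finset.mem_filter.mp hw).2, map_one]
    have h2 : (S.val.map fun w : F × F => Polynomial.X + Polynomial.C w.1).prod =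
        (Polynomial.X + 1) ^ (S.filter fun w => w.1 = 1).card * R := by
      rw [← h1, hR, Finset.prod_filter_mul_prod_filter_not]
      rfl
    rw [hM, Multiset.map_add, Multiset.prod_add, h2]
    simp [pow_add]
    ring
  have hdegM : i ≤ M.card := by
    have h1 : (M.map fun w : F × F => Polynomial.X + Polynomial.C w.1).prod.natDegree ≤ M.card :=
      (Polynomial.natDegree_multiset_prod_le _).trans (by simp)
    rw [hprod] at h1
    exact (Polynomial.le_natDegree_of_ne_zero hi).trans h1
  set t : Fin 2 →₀ ℕ := Finsupp.single 0 i + Finsupp.single 1 (M.card - i) with ht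
  have hcoeff : (MvPolynomial.affineProd M).coeff t ≠ 0 := by
    rwa [ht, MvPolynomial.coeff_affineProd M i _ (by omega), hprod]
  have htdeg : t.degree = M.card := by
    rw [ht, map_add, Finsupp.degree_single, Finsupp.degree_single]
    omega
  have htot : (MvPolynomial.affineProd M).totalDegree = t.degree := by
    refine le_antisymm (htdeg ▸ MvPolynomial.totalDegree_affineProd_le M) ?_
    exact MvPolynomial.le_totalDegree (MvPolynomial.mem_support_iff.mpr hcoeff)
  obtain ⟨x, hx, hne⟩ := MvPolynomial.combinatorial_nullstellensatz_exists_eval_nonzero _ t hcoeff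
    htot ![A, B] (by
      intro r
      fin_cases r
      · simp [ht]; omega
      · simp [ht]; omega)
  have hxA : x 0 ∈ A := hx 0
  have hxB : x 1 ∈ B := hx 1
  have hfactor : ∀ w ∈ M, x 0 + w.1 * x 1 ≠ w.2 := by
    intro w hw h
    apply hne
    rw [MvPolynomial.affineProd, map_multiset_prod, Multiset.map_map]
    refine Multiset.prod_eq_zero (Multiset.mem_map.mpr ⟨w, hw, ?_⟩)
    simp [h]
  have hxC : x 0 + x 1 ∈ C := by
    rw [hC, Set.Finite.mem_toFinset]
    exact ⟨x 0, hxA, x 1, hxB, fun w hw => hfactor w (Multiset.mem_add.mpr (.inl hw)), rfl⟩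
  exact hfactor (1, x 0 + x 1)
    (Multiset.mem_add.mpr (.inr (Multiset.mem_map.mpr ⟨_, hxC, rfl⟩))) (by simp)


/-- Corollary 3: Let `F` be a field of characteristic `p` (with `p = ∞`,
i.e. `⊤ : ℕ∞`, when `char F = 0`), `A, B` finite nonempty subsets of `F`, and
`S ⊆ F^× × F` finite and nonempty.  Then
`|{a+b : a ∈ A, b ∈ B, a + u·b ≠ v for all (u,v) ∈ S}|
  ≥ min{p − |{v ∈ F : (1,v) ∈ S}|, |A| + |B| − 2|S| − 1}`. -/
theorem card_restricted_sumset_linear_constraints {F : Type*} [Field F]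
    (A B : Finset F) (hA : A.Nonempty) (hB : B.Nonempty)
    (S : Finset (F × F)) (hS : S.Nonempty) (hS0 : ∀ uv ∈ S, uv.1 ≠ 0) :
    min ((if ringChar F = 0 then (⊤ : ℕ∞) else (ringChar F : ℕ∞))
          - ({v : F | (1, v) ∈ S}.ncard : ℕ∞))
        ((A.card : ℕ∞) + (B.card : ℕ∞) - 2 * (S.card : ℕ∞) - 1)
      ≤ ({c : F | ∃ a ∈ A, ∃ b ∈ B,
            (∀ uv ∈ S, a + uv.1 * b ≠ uv.2) ∧ a + b = c}.ncard : ℕ∞) := by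
  change _ ≤ ((restrictedSumset A B S).ncard : ℕ∞)
  by_contra! h
  obtain ⟨h1, h2⟩ := lt_min_iff.mp h
  have h2' : (restrictedSumset A B S).ncard < A.card + B.card - 2 * S.card - 1 := by
    exact_mod_cast h2
  have := card_add_card_le_of_natCast_ne_zero A B hA hB S hS0 fun k hk hkN hk0 => by
    have hdvd := (ringChar.spec F k).mp hk0
    split_ifs at h1 with hp
    · rw [hp, zero_dvd_iff] at hdvd
      omega
    · have h1' : (restrictedSumset A B S).ncard <
          ringChar F - {v : F | (1, v) ∈ S}.ncard := by exact_mod_cast h1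
      have := Nat.le_of_dvd hk hdvd
      omega
  omega
end

section
/- Let F be a field of characteristic p (with the convention p = ∞ if F has characteristic zero), and let A and B be finite subsets of F with |A| > 1 and |B| > 1. Then |{a+b : a ∈ A, b ∈ B, and a·b ≠ 1}| ≥ min{p, |A| + |B| − 3}. -/
open MvPolynomial in
/-- The product of the linear forms `X₀ + X₁ - c`, where `c` runs over a multiset. -/
noncomputable def prodAddSubC {F : Type*} [Field F] (s : Multiset F) : MvPolynomial (Fin 2) F :=
  (s.map fun c => X 0 + X 1 - C c).prod

open MvPolynomial in
theorem prodAddSubC_cons {F : Type*} [Field F] (c : F) (s : Multiset F) :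
    prodAddSubC (c ::ₘ s) = (X 0 + X 1 - C c) * prodAddSubC s := by
  simp [prodAddSubC]

open MvPolynomial in
theorem eval_prodAddSubC_eq_zero {F : Type*} [Field F] {s : Multiset F} {x : Fin 2 → F}
    (hx : x 0 + x 1 ∈ s) : eval x (prodAddSubC s) = 0 := by
  obtain ⟨t, rfl⟩ := Multiset.exists_cons_of_mem hx
  simp [prodAddSubC_cons]

theorem totalDegree_prodAddSubC_le {F : Type*} [Field F] (s : Multiset F) :
    (prodAddSubC s).totalDegree ≤ s.card := by
  induction s using Multiset.induction_on with
  | empty => simp [prodAddSubC]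
  | cons c s ih =>
    rw [prodAddSubC_cons, Multiset.card_cons, add_comm s.card]
    refine (MvPolynomial.totalDegree_mul _ _).trans (add_le_add ?_ ih)
    refine (MvPolynomial.totalDegree_sub_C_le _ _).trans
      ((MvPolynomial.totalDegree_add _ _).trans ?_)
    simp

/-- The exponent vector of the monomial `X₀ ^ i * X₁ ^ j`. -/
noncomputable def exponentPair (i j : ℕ) : Fin 2 →₀ ℕ :=
  Finsupp.single 0 i + Finsupp.single 1 j

theorem exponentPair_succ_left (i j : ℕ) :
    exponentPair (i + 1) j = Finsupp.single 0 1 + exponentPair i j := by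
  ext k; fin_cases k <;> simp [exponentPair, add_comm]

theorem exponentPair_succ_right (i j : ℕ) :
    exponentPair i (j + 1) = Finsupp.single 1 1 + exponentPair i j := by
  ext k; fin_cases k <;> simp [exponentPair, add_comm]

theorem degree_exponentPair (i j : ℕ) : (exponentPair i j).degree = i + j := by
  simp [exponentPair]

open MvPolynomial in
theorem coeff_exponentPair_eq_zero {F : Type*} [Field F] {f : MvPolynomial (Fin 2) F} {i j : ℕ}
    (h : f.totalDegree < i + j) : coeff (exponentPair i j) f = 0 := by
  apply coeff_eq_zero_of_totalDegree_lt
  rwa [← Finsupp.degree_apply, degree_exponentPair]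

open MvPolynomial in
theorem coeff_X_zero_mul_exponentPair_zero {F : Type*} [Field F] (f : MvPolynomial (Fin 2) F)
    (j : ℕ) : coeff (exponentPair 0 j) (X 0 * f) = 0 := by
  rw [coeff_X_mul', if_neg]; simp [exponentPair]

open MvPolynomial in
theorem coeff_X_one_mul_exponentPair_zero {F : Type*} [Field F] (f : MvPolynomial (Fin 2) F)
    (i : ℕ) : coeff (exponentPair i 0) (X 1 * f) = 0 := by
  rw [coeff_X_mul', if_neg]; simp [exponentPair]

open MvPolynomial in
theorem coeff_prodAddSubC {F : Type*} [Field F] (s : Multiset F) {i j : ℕ}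
    (h : i + j = s.card) :
    coeff (exponentPair i j) (prodAddSubC s) = (s.card.choose i : F) := by
  induction s using Multiset.induction_on generalizing i j with
  | empty =>
    obtain ⟨rfl, rfl⟩ : i = 0 ∧ j = 0 := by simpa using h
    simp [prodAddSubC, exponentPair]
  | cons c s ih =>
    rw [Multiset.card_cons] at h ⊢
    have hc : coeff (exponentPair i j) (prodAddSubC s) = 0 :=
      coeff_exponentPair_eq_zero ((totalDegree_prodAddSubC_le s).trans_lt (by omega))
    rw [prodAddSubC_cons, sub_mul, add_mul, coeff_sub, coeff_add, coeff_C_mul, hc, mul_zero,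
      sub_zero]
    rcases i with _ | i
    · obtain ⟨j, rfl⟩ : ∃ k, j = k + 1 := ⟨s.card, by omega⟩
      rw [coeff_X_zero_mul_exponentPair_zero, exponentPair_succ_right, coeff_X_mul,
        ih (by omega)]
      simp
    · rw [exponentPair_succ_left, coeff_X_mul, ih (by omega), ← exponentPair_succ_left]
      rcases j with _ | j
      · rw [coeff_X_one_mul_exponentPair_zero]
        obtain rfl : i = s.card := by omega
        simp
      · rw [exponentPair_succ_right, coeff_X_mul, ih (by omega), Nat.choose_succ_succ]
        push_cast
        ring

open MvPolynomial in
theorem card_lt_of_add_mem_of_mul_ne_one {F : Type*} [Field F] {A B : Finset F} {n : ℕ}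
    (hA : 1 < A.card) (hB : 1 < B.card) (hn : A.card + B.card = n + 4)
    (hfact : (n.factorial : F) ≠ 0) {S : Finset F}
    (hS : ∀ a ∈ A, ∀ b ∈ B, a * b ≠ 1 → a + b ∈ S) : n < S.card := by
  by_contra! hle
  obtain ⟨i, hi⟩ : ∃ i, A.card = i + 2 := ⟨A.card - 2, by omega⟩
  obtain ⟨j, hj⟩ : ∃ j, B.card = j + 2 := ⟨B.card - 2, by omega⟩
  obtain rfl : n = i + j := by omega
  set s : Multiset F := S.val + Multiset.replicate (i + j - S.card) 0 with hs
  have hcard : s.card = i + j := by simp [hs]; omega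
  have hdeg := totalDegree_prodAddSubC_le s
  have hcoeff : coeff (exponentPair (i + 1) (j + 1)) ((X 0 * X 1 - 1) * prodAddSubC s) ≠ 0 := by
    rw [sub_mul, one_mul, coeff_sub, coeff_exponentPair_eq_zero (hdeg.trans_lt (by omega)),
      sub_zero, mul_assoc, exponentPair_succ_left, coeff_X_mul, exponentPair_succ_right,
      coeff_X_mul, coeff_prodAddSubC s hcard.symm, hcard]
    intro h
    apply hfact
    rw [← Nat.choose_mul_factorial_mul_factorial (Nat.le_add_right i j)]
    push_cast
    simp [h]
  have htotal : ((X 0 * X 1 - 1) * prodAddSubC s).totalDegree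
      = (exponentPair (i + 1) (j + 1)).degree := by
    refine le_antisymm ?_ (not_lt.1 fun h => hcoeff (coeff_exponentPair_eq_zero
      (by rwa [degree_exponentPair] at h)))
    rw [degree_exponentPair]
    have hXX : (X 0 * X 1 - 1 : MvPolynomial (Fin 2) F).totalDegree ≤ 2 := by
      rw [← C_1]
      refine (totalDegree_sub_C_le _ _).trans ((totalDegree_mul _ _).trans ?_)
      simp
    have := totalDegree_mul (X 0 * X 1 - 1) (prodAddSubC s)
    omega
  obtain ⟨x, hx, hne⟩ := combinatorial_nullstellensatz_exists_eval_nonzero _ _ hcoeff htotal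
    ![A, B] (by intro k; fin_cases k <;> simp [exponentPair, hi, hj])
  apply hne
  rw [map_mul]
  by_cases h : x 0 * x 1 = 1
  · simp [h]
  · rw [eval_prodAddSubC_eq_zero, mul_zero]
    exact Multiset.mem_add.2 (Or.inl (hS _ (hx 0) _ (hx 1) h))

theorem factorial_cast_ne_zero_of_lt_ringChar {F : Type*} [Field F] {n : ℕ}
    (h : ringChar F = 0 ∨ n < ringChar F) : (n.factorial : F) ≠ 0 := by
  rw [Ne, ringChar.spec]
  rcases CharP.char_is_prime_or_zero F (ringChar F) with hp | h0
  · rw [hp.dvd_factorial]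
    have := hp.pos
    omega
  · rw [h0, zero_dvd_iff]
    exact n.factorial_ne_zero


/-- If `F` is a field of characteristic `p` (with `p = ∞`, i.e. `⊤ : ℕ∞`,
when `char F = 0`) and `A`, `B` are finite subsets of `F` with `|A| > 1` and `|B| > 1`, then
`|{a+b : a ∈ A, b ∈ B, a·b ≠ 1}| ≥ min{p, |A| + |B| − 3}`. -/
theorem card_restricted_sumset_mul_ne_one {F : Type*} [Field F] (A B : Finset F)
    (hA : 1 < A.card) (hB : 1 < B.card) :
    min (if ringChar F = 0 then (⊤ : ℕ∞) else (ringChar F : ℕ∞))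
        ((A.card : ℕ∞) + (B.card : ℕ∞) - 3)
      ≤ ({c : F | ∃ a ∈ A, ∃ b ∈ B, a * b ≠ 1 ∧ a + b = c}.ncard : ℕ∞) := by
  have hfin : {c : F | ∃ a ∈ A, ∃ b ∈ B, a * b ≠ 1 ∧ a + b = c}.Finite := by
    refine (Set.Finite.image2 (· + ·) A.finite_toSet B.finite_toSet).subset ?_
    rintro c ⟨a, ha, b, hb, -, rfl⟩
    exact Set.mem_image2_of_mem ha hb
  rw [Set.ncard_eq_toFinset_card _ hfin]
  have hS : ∀ a ∈ A, ∀ b ∈ B, a * b ≠ 1 → a + b ∈ hfin.toFinset := fun a ha b hb hab =>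
    hfin.mem_toFinset.2 ⟨a, ha, b, hb, hab, rfl⟩
  by_cases h : ringChar F = 0 ∨ A.card + B.card - 4 < ringChar F
  · have := card_lt_of_add_mem_of_mul_ne_one hA hB
      (show A.card + B.card = (A.card + B.card - 4) + 4 by omega)
      (factorial_cast_ne_zero_of_lt_ringChar h) hS
    refine (min_le_right _ _).trans ?_
    norm_cast
    omega
  · push Not at h
    obtain ⟨hp, hlt⟩ := h
    rw [if_neg hp]
    refine (min_le_left _ _).trans ?_
    obtain ⟨A', hA', hcA⟩ := Finset.exists_subset_card_eq
      (show min A.card (ringChar F + 1) ≤ A.card from min_le_left _ _)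
    obtain ⟨B', hB', hcB⟩ := Finset.exists_subset_card_eq
      (show ringChar F + 3 - A'.card ≤ B.card by omega)
    have := card_lt_of_add_mem_of_mul_ne_one (n := ringChar F - 1)
      (show 1 < A'.card by omega) (show 1 < B'.card by omega) (by omega)
      (factorial_cast_ne_zero_of_lt_ringChar (by omega))
      (fun a ha b hb => hS a (hA' ha) b (hB' hb))
    norm_cast
    omega
end

section
/- Let F be a finite field with |F| = 2^n > 2. Let A and S be subsets of F with |A| > 2^{n−1} + 1 and |S| = 2^n − 1. Then {a+b : a ∈ A, b ∈ F, and a − b ∉ S} = F \ S, and hence |{a+b : a ∈ A, b ∈ F, and a − b ∉ S}| = 1 < min{2, |A| + |F| − |S| − 2^{n−1} − 1}. (In particular, the hypothesis p ≠ 2 cannot be omitted from the restricted-sumset lower bound min{p, |A| + |B| − |S| − q − 1}.) -/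
/-- Let `F` be a finite field with `|F| = 2^n > 2`, and let `A, S ⊆ F` with
`|A| > 2^(n−1) + 1` and `|S| = 2^n − 1`.  Then
`{a+b : a ∈ A, b ∈ F, a − b ∉ S} = F \ S`, hence this set has exactly one element, and
`1 < min{2, |A| + |F| − |S| − 2^(n−1) − 1}` (showing the hypothesis `p ≠ 2` cannot be
omitted from the restricted-sumset lower bound). -/
theorem char_two_counterexample {F : Type*} [Field F] [Fintype F] (n : ℕ)
    (hF : Fintype.card F = 2 ^ n) (hF2 : 2 < Fintype.card F)
    (A S : Finset F) (hA : 2 ^ (n - 1) + 1 < A.card) (hS : S.card = 2 ^ n - 1) :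
    {c : F | ∃ a ∈ A, ∃ b : F, a - b ∉ S ∧ a + b = c} = Set.univ \ ↑S ∧
    {c : F | ∃ a ∈ A, ∃ b : F, a - b ∉ S ∧ a + b = c}.ncard = 1 ∧
    1 < min 2 (A.card + Fintype.card F - S.card - 2 ^ (n - 1) - 1) := by
  have : CharP F 2 := charP_of_card_eq_prime_pow hF
  have hpos : 0 < 2 ^ n := by positivity
  obtain ⟨x, hx⟩ : A.Nonempty := Finset.card_pos.mp (Nat.zero_lt_of_lt hA)
  have hset : {c : F | ∃ a ∈ A, ∃ b : F, a - b ∉ S ∧ a + b = c} = Set.univ \ ↑S := by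
    ext c
    simp only [Set.mem_ofPred_eq, Set.mem_sdiff, Set.mem_univ, true_and, Finset.mem_coe,
      CharTwo.sub_eq_add]
    constructor
    · rintro ⟨a, -, b, hab, rfl⟩
      exact hab
    · intro hc
      have hadd : x + (c - x) = c := add_sub_cancel x c
      rw [CharTwo.sub_eq_add] at hadd
      exact ⟨x, hx, c + x, by rwa [hadd], hadd⟩
  refine ⟨hset, ?_, ?_⟩
  · rw [hset, ← Set.compl_eq_univ_sdiff, Set.ncard_compl, Set.ncard_coe_finset,
      Nat.card_eq_fintype_card, hF, hS]
    omega
  · rw [hF, hS, lt_min_iff]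
    omega
end

section
/- Let F be a field, let A and B be finite nonempty subsets of F, and let P(x,y) be a polynomial over F of total degree d. Suppose that for some integer j with 0 ≤ j ≤ |B|−1 the coefficient of x^{d−j} y^j in P is nonzero. Then there exists b₀ ∈ B such that the one-variable polynomial P(x, b₀) is not identically zero, and consequently |{a+b : a ∈ A, b ∈ B, and P(a,b) ≠ 0}| ≥ |A| − d. -/
theorem MvPolynomial.coeff_eq_zero_of_totalDegree_lt_add {R : Type*} [CommSemiring R]
    {P : MvPolynomial (Fin 2) R} {i k : ℕ} (h : P.totalDegree < i + k) :
    MvPolynomial.coeff (Finsupp.single 0 i + Finsupp.single 1 k) P = 0 := by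
  apply MvPolynomial.coeff_eq_zero_of_totalDegree_lt
  rw [← Finsupp.degree_apply, map_add, Finsupp.degree_single, Finsupp.degree_single]
  exact h

namespace Polynomial

theorem coeff_coeff_aeval_X_C_X {R : Type*} [CommSemiring R]
    (P : MvPolynomial (Fin 2) R) (i k : ℕ) :
    ((MvPolynomial.aeval ![(X : R[X][X]), C X] P).coeff i).coeff k =
      MvPolynomial.coeff (Finsupp.single 0 i + Finsupp.single 1 k) P := by
  induction P using MvPolynomial.induction_on' with
  | add p q hp hq => simp [hp, hq]
  | monomial u a =>
    have hiff : u = Finsupp.single 0 i + Finsupp.single 1 k ↔ i = u 0 ∧ k = u 1 := by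
      constructor
      · rintro rfl
        simp
      · rintro ⟨rfl, rfl⟩
        ext s
        fin_cases s <;> simp
    rw [MvPolynomial.coeff_monomial, MvPolynomial.aeval_monomial,
      Finsupp.prod_fintype _ _ (fun _ => pow_zero _)]
    have hC : algebraMap R R[X][X] a = C (C a) := rfl
    simp only [hiff, hC, Fin.prod_univ_two, Matrix.cons_val_zero, Matrix.cons_val_one,
      coeff_C_mul, ← C_pow, coeff_mul_C, coeff_X_pow]
    by_cases hi : i = u 0 <;> by_cases hk : k = u 1 <;> simp [hi, hk, coeff_X_pow]

theorem map_evalRingHom_aeval_X_C_X {R : Type*} [CommSemiring R]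
    (P : MvPolynomial (Fin 2) R) (b : R) :
    (MvPolynomial.aeval ![(X : R[X][X]), C X] P).map (evalRingHom b) =
      MvPolynomial.aeval ![(X : R[X]), C b] P := by
  induction P using MvPolynomial.induction_on with
  | C a =>
    have hC : algebraMap R R[X][X] a = C (C a) := rfl
    simp [hC]
  | add p q hp hq => simp [hp, hq]
  | mul_X p s hp =>
    simp only [map_mul, Polynomial.map_mul, hp, MvPolynomial.aeval_X]
    fin_cases s <;> simp

theorem eval_aeval_X_C {R : Type*} [CommSemiring R]
    (P : MvPolynomial (Fin 2) R) (a b : R) :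
    (MvPolynomial.aeval ![(X : R[X]), C b] P).eval a =
      MvPolynomial.eval ![a, b] P := by
  induction P using MvPolynomial.induction_on with
  | C r => simp
  | add p q hp hq => simp [hp, hq]
  | mul_X p s hp =>
    simp only [map_mul, Polynomial.eval_mul, hp, MvPolynomial.aeval_X, MvPolynomial.eval_X]
    fin_cases s <;> simp

theorem natDegree_aeval_X_C_le {R : Type*} [CommSemiring R]
    (P : MvPolynomial (Fin 2) R) (b : R) :
    (MvPolynomial.aeval ![(X : R[X]), C b] P).natDegree ≤ P.totalDegree := by
  rw [natDegree_le_iff_coeff_eq_zero]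
  intro n hn
  have hzero : (MvPolynomial.aeval ![(X : R[X][X]), C X] P).coeff n = 0 := by
    ext k
    rw [coeff_coeff_aeval_X_C_X, coeff_zero]
    exact MvPolynomial.coeff_eq_zero_of_totalDegree_lt_add (by omega)
  rw [← map_evalRingHom_aeval_X_C_X, Polynomial.coeff_map, hzero, map_zero]

theorem exists_aeval_X_C_ne_zero {R : Type*} [CommRing R] [IsDomain R]
    (P : MvPolynomial (Fin 2) R) (B : Finset R) {j : ℕ} (hjB : j < B.card)
    (hj : MvPolynomial.coeff (Finsupp.single 0 (P.totalDegree - j) + Finsupp.single 1 j) P ≠ 0) :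
    ∃ b ∈ B, MvPolynomial.aeval ![(X : R[X]), C b] P ≠ 0 := by
  by_contra! h
  have hjd : j ≤ P.totalDegree := by
    by_contra hlt
    exact hj (MvPolynomial.coeff_eq_zero_of_totalDegree_lt_add (by omega))
  set g := (MvPolynomial.aeval ![(X : R[X][X]), C X] P).coeff (P.totalDegree - j) with hg
  have hdeg : g.natDegree ≤ j := by
    rw [natDegree_le_iff_coeff_eq_zero]
    intro k hk
    rw [hg, coeff_coeff_aeval_X_C_X]
    exact MvPolynomial.coeff_eq_zero_of_totalDegree_lt_add (by omega)
  have hg0 : g = 0 := by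
    refine eq_zero_of_natDegree_lt_card_of_eval_eq_zero' g B (fun b hb => ?_) (by omega)
    rw [← coe_evalRingHom, hg, ← Polynomial.coeff_map, map_evalRingHom_aeval_X_C_X, h b hb,
      coeff_zero]
  apply hj
  rw [← coeff_coeff_aeval_X_C_X, ← hg, hg0, coeff_zero]

theorem card_sub_natDegree_le_card_filter_eval_ne_zero {R : Type*} [CommRing R]
    [IsDomain R] [DecidableEq R] {f : R[X]} (hf : f ≠ 0) (A : Finset R) :
    A.card - f.natDegree ≤ (A.filter fun a => f.eval a ≠ 0).card := by
  have hroots : (A.filter fun a => f.eval a = 0).card ≤ f.natDegree := by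
    refine card_le_degree_of_subset_roots fun a ha => ?_
    simp only [Finset.mem_val, Finset.mem_filter] at ha
    exact (mem_roots hf).2 ha.2
  have hsplit := A.card_filter_add_card_filter_not (fun a => f.eval a = 0)
  simp only [ne_eq]
  omega

end Polynomial

/-- Let `F` be a field, `A, B` finite nonempty subsets of `F`, and `P(x,y)`
a polynomial over `F` of total degree `d` whose coefficient of `x^(d−j) y^j` is nonzero
for some `0 ≤ j ≤ |B|−1`.  Then some `b₀ ∈ B` makes the univariate polynomial `P(x, b₀)`
not identically zero, and consequently
`|{a+b : a ∈ A, b ∈ B, P(a,b) ≠ 0}| ≥ |A| − d`. -/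
theorem exists_nonvanishing_specialization {F : Type*} [Field F]
    (A B : Finset F) (hA : A.Nonempty) (hB : B.Nonempty)
    (P : MvPolynomial (Fin 2) F) (d : ℕ) (hd : P.totalDegree = d)
    (hj : ∃ j < B.card,
      MvPolynomial.coeff (Finsupp.single 0 (d - j) + Finsupp.single 1 j) P ≠ 0) :
    (∃ b₀ ∈ B,
        (MvPolynomial.aeval ![Polynomial.X, Polynomial.C b₀]) P ≠ (0 : Polynomial F)) ∧
    A.card - d ≤
      {c : F | ∃ a ∈ A, ∃ b ∈ B, MvPolynomial.eval ![a, b] P ≠ 0 ∧ a + b = c}.ncard := by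
  classical
  subst hd
  obtain ⟨j, hjB, hj⟩ := hj
  obtain ⟨b, hb, hne⟩ := Polynomial.exists_aeval_X_C_ne_zero P B hjB hj
  refine ⟨⟨b, hb, hne⟩, ?_⟩
  have hfin : {c : F | ∃ a ∈ A, ∃ b ∈ B, MvPolynomial.eval ![a, b] P ≠ 0 ∧ a + b = c}.Finite := by
    refine ((A ×ˢ B).image fun p => p.1 + p.2).finite_toSet.subset ?_
    rintro _ ⟨a, ha, b, hb, -, rfl⟩
    exact Finset.mem_coe.2 (Finset.mem_image.2 ⟨(a, b), Finset.mk_mem_product ha hb, rfl⟩)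
  set f := MvPolynomial.aeval ![(Polynomial.X : Polynomial F), Polynomial.C b] P with hf
  calc A.card - P.totalDegree
      ≤ A.card - f.natDegree := Nat.sub_le_sub_left (Polynomial.natDegree_aeval_X_C_le P b) _
    _ ≤ (A.filter fun a => f.eval a ≠ 0).card :=
        Polynomial.card_sub_natDegree_le_card_filter_eval_ne_zero hne A
    _ = ((A.filter fun a => f.eval a ≠ 0).image (· + b)).card :=
        (Finset.card_image_of_injective _ (add_left_injective b)).symm
    _ ≤ _ := by
        rw [← Set.ncard_coe_finset]
        refine Set.ncard_le_ncard ?_ hfin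
        intro c hc
        obtain ⟨a, ha, rfl⟩ := Finset.mem_image.1 (Finset.mem_coe.1 hc)
        rw [Finset.mem_filter, hf, Polynomial.eval_aeval_X_C] at ha
        exact ⟨a, ha.1, b, hb, ha.2, rfl⟩
end

section
/- Let F be a field, let α ∈ F, and let P(x), Q(x) ∈ F[x] with P(x) = (x − α)·Q(x). Suppose there exist nonnegative integers k < l such that the coefficient of x^i in P(x) vanishes for every integer i with k < i < l. Then for every integer i with k ≤ i < l, the coefficient of x^i in Q(x) equals α^{l−1−i} times the coefficient of x^{l−1} in Q(x). -/
/-- If `P(x) = (x − α) Q(x)` and the coefficients of `P` vanish in the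
open range `(k, l)`, then `Q̂(i) = α^(l−1−i) · Q̂(l−1)` for all `i ∈ [k, l)`. -/
theorem coeff_geometric_of_midrange_vanish {F : Type*} [Field F] (α : F)
    (P Q : Polynomial F) (hPQ : P = (Polynomial.X - Polynomial.C α) * Q)
    (k l : ℕ) (hkl : k < l) (hcoeff : ∀ i : ℕ, k < i → i < l → P.coeff i = 0) :
    ∀ i : ℕ, k ≤ i → i < l → Q.coeff i = α ^ (l - 1 - i) * Q.coeff (l - 1) := by
  have step : ∀ i, k ≤ i → i + 1 < l → Q.coeff i = α * Q.coeff (i + 1) := by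
    intro i hki hil
    have h := hcoeff (i + 1) (by omega) hil
    rwa [hPQ, sub_mul, Polynomial.coeff_sub, Polynomial.coeff_X_mul, Polynomial.coeff_C_mul,
      sub_eq_zero] at h
  have geometric : ∀ d i, k ≤ i → i + d < l → Q.coeff i = α ^ d * Q.coeff (i + d) := by
    intro d
    induction d with
    | zero => simp
    | succ d ih =>
      intro i hki hil
      rw [ih i hki (by omega), step (i + d) (by omega) (by omega), pow_succ, mul_assoc, add_assoc]
  intro i hki hil
  have h := geometric (l - 1 - i) i hki (by omega)
  rwa [show i + (l - 1 - i) = l - 1 by omega] at h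
end

section
/- Let E be an algebraically closed field, and let P(x) = ∏_{j=1}^{n} (x − α_j)^{m_j}, where α_1, …, α_n are distinct nonzero elements of E and m_1, …, m_n are positive integers. For each j set P_j(x) = P(x)/(x − α_j). Suppose there exist nonnegative integers k < l with n ≤ l − 1 − k such that the coefficient of x^i in P(x) vanishes for every integer i with k < i < l. Then for every j = 1, …, n, the element m_j · P̂_j(l−1) of E is zero, where P̂_j(l−1) denotes the coefficient of x^{l−1} in P_j(x) and m_j · c means the m_j-fold sum c + ⋯ + c in E. -/
open Polynomial in
/-- Across a gap in the coefficients of `(X - a) * Q`, the coefficients of `Q` form a geometric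
progression with ratio `a`. -/
theorem coeff_sub_eq_pow_mul_coeff_of_gap {R : Type*} [CommRing R] {a : R} {P Q : R[X]}
    (h : (X - C a) * Q = P) {k l : ℕ}
    (hcoeff : ∀ i : ℕ, k < i → i < l → P.coeff i = 0) {s : ℕ} (hs : s ≤ l - 1 - k) :
    Q.coeff (l - 1 - s) = a ^ s * Q.coeff (l - 1) := by
  induction s with
  | zero => simp
  | succ s ih =>
    have hi : l - 1 - s = l - 1 - (s + 1) + 1 := by omega
    have h0 := hcoeff (l - 1 - s) (by omega) (by omega)
    rw [← h, hi, coeff_X_sub_C_mul, ← hi, ih (by omega),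
      sub_eq_zero] at h0
    rw [h0]
    ring

open Polynomial in
/-- The logarithmic derivative formula for a product of powers of linear factors, with the
denominators cleared. -/
theorem derivative_prod_X_sub_C_pow {K ι : Type*} [Field K] [Fintype ι] (α : ι → K) (m : ι → ℕ)
    {P : K[X]} (hP : P = ∏ j, (X - C (α j)) ^ m j) {Q : ι → K[X]}
    (hQ : ∀ j, (X - C (α j)) * Q j = P) :
    derivative P = ∑ j, C (m j : K) * Q j := by
  classical
  have hrest (j : ι) : (m j : K[X]) * (X - C (α j)) ^ (m j - 1) *
      ∏ i ∈ Finset.univ.erase j, (X - C (α i)) ^ m i = (m j : K[X]) * Q j := by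
    rcases Nat.eq_zero_or_pos (m j) with h0 | hpos
    · simp [h0]
    apply mul_left_cancel₀ (X_sub_C_ne_zero (α j))
    rw [mul_left_comm _ _ (Q j), hQ, hP, ← Finset.mul_prod_erase _ _ (Finset.mem_univ j),
      ← mul_pow_sub_one hpos.ne']
    ring
  rw [hP, derivative_prod_finset]
  refine Finset.sum_congr rfl fun j _ => ?_
  rw [derivative_X_sub_C_pow, map_natCast, ← hrest]
  ring

/-- Let `E` be algebraically closed, `P(x) = ∏_{j=1}^n (x − α_j)^{m_j}` with
the `α_j` distinct nonzero elements of `E` and the `m_j` positive. Set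
`P_j(x) = P(x)/(x − α_j)`. If there are nonnegative integers `k < l` with `n ≤ l − 1 − k`
such that the coefficient of `x^i` in `P` vanishes for all `k < i < l`, then
`m_j · P̂_j(l−1) = 0` in `E` for every `j`. -/
theorem mul_coeff_quot_eq_zero {E : Type*} [Field E] [IsAlgClosed E] (n : ℕ)
    (α : Fin n → E) (hinj : Function.Injective α) (hne : ∀ j, α j ≠ 0)
    (m : Fin n → ℕ) (hm : ∀ j, 0 < m j)
    (P : Polynomial E) (hP : P = ∏ j, (Polynomial.X - Polynomial.C (α j)) ^ m j)
    (k l : ℕ) (hkl : k < l) (hn : n ≤ l - 1 - k)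
    (hcoeff : ∀ i : ℕ, k < i → i < l → P.coeff i = 0) :
    ∀ j, (m j : E) * (P / (Polynomial.X - Polynomial.C (α j))).coeff (l - 1) = 0 := by
  have hmul (j : Fin n) : (Polynomial.X - Polynomial.C (α j)) *
      (P / (Polynomial.X - Polynomial.C (α j))) = P := by
    refine EuclideanDomain.mul_div_cancel' (Polynomial.X_sub_C_ne_zero _) ?_
    rw [hP]
    exact (dvd_pow_self _ (hm j).ne').trans (Finset.dvd_prod_of_mem _ (Finset.mem_univ j))
  have hder := derivative_prod_X_sub_C_pow α m hP hmul
  have hv : (fun j => α j * ((m j : E) *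
      (P / (Polynomial.X - Polynomial.C (α j))).coeff (l - 1))) = 0 := by
    refine Matrix.eq_zero_of_forall_pow_sum_mul_pow_eq_zero hinj fun s => ?_
    have hs : (s : ℕ) + 1 ≤ l - 1 - k := (Nat.succ_le_of_lt s.2).trans hn
    have h0 := congrArg (fun p => Polynomial.coeff p (l - 1 - (s + 1))) hder
    simp only [Polynomial.coeff_derivative, Polynomial.finsetSum_coeff,
      Polynomial.coeff_C_mul] at h0
    rw [hcoeff _ (by omega) (by omega), zero_mul] at h0
    rw [h0]
    refine Finset.sum_congr rfl fun j _ => ?_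
    rw [coeff_sub_eq_pow_mul_coeff_of_gap (hmul j) hcoeff hs]
    ring
  intro j
  exact (mul_eq_zero.mp (congrFun hv j)).resolve_left (hne j)
end
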